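/- Assume N = 2, −λ₁(B) < λ < 0, 2 < p ≤ 6 and 2ks ≤ 6 − p. Then the problem (P_λ) admits exactly one positive solution, and this solution is radially symmetric and decreasing with respect to the radial variable r = |x|. -/

import Mathlib

open MeasureTheory Set Filter Topology

noncomputable section

/-- `N`-dimensional Euclidean space. -/
abbrev Euc (N : ℕ) := EuclideanSpace ℝ (Fin N)

/-- The Laplacian of a real-valued function on Euclidean space, defined as the
sum of the pure second partial derivatives in the coordinate directions. -/
def lap {N : ℕ} (u : Euc N → ℝ) (x : Euc N) : ℝ :=
  ∑ i : Fin N,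
    fderiv ℝ (fun y => fderiv ℝ u y (EuclideanSpace.single i 1)) x (EuclideanSpace.single i 1)

/-- The first Dirichlet eigenvalue of `-Δ` on `Ω`, defined as the infimum of
Rayleigh quotients of nonzero smooth functions with compact support contained in `Ω`. -/
def firstEig {N : ℕ} (Ω : Set (Euc N)) : ℝ :=
  sInf { r : ℝ | ∃ φ : Euc N → ℝ, ContDiff ℝ (⊤ : ℕ∞) φ ∧ HasCompactSupport φ ∧
    tsupport φ ⊆ Ω ∧ φ ≠ 0 ∧
    r = (∫ x, ‖fderiv ℝ φ x‖ ^ 2) / (∫ x, (φ x) ^ 2) }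

/-- `u` is a (classical) positive solution of `-Δ u + lam • u = f(x, u)` in `Ω`,
vanishing on the boundary: `u ∈ C²(Ω) ∩ C(closure Ω)`, `u > 0` in `Ω`, `u = 0` on `∂Ω`. -/
def IsPosSolution {N : ℕ} (Ω : Set (Euc N)) (f : Euc N → ℝ → ℝ) (lam : ℝ)
    (u : Euc N → ℝ) : Prop :=
  ContDiffOn ℝ 2 u Ω ∧ ContinuousOn u (closure Ω) ∧ (∀ x ∈ Ω, 0 < u x) ∧
    (∀ x ∈ frontier Ω, u x = 0) ∧ ∀ x ∈ Ω, - lap u x + lam * u x = f x (u x)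


/-- The nonlinearity `(1 + |x|^k)^{-s} t^{p-1}` of problem `(P_λ)` on the unit ball. -/
def fker (N : ℕ) (k s p : ℝ) : Euc N → ℝ → ℝ :=
  fun x t => (1 + ‖x‖ ^ k) ^ (-s) * t ^ (p - 1)

section LaplacianCalculus

variable {E : Type*} [NormedAddCommGroup E] [InnerProductSpace ℝ E]

/-- The second derivative along a line through a point where `u` is `C²`. -/
lemma deriv_deriv_line {u : E → ℝ} {x : E} (hu : ContDiffAt ℝ 2 u x) (v : E) :
    deriv (deriv fun t : ℝ => u (x + t • v)) 0 = fderiv ℝ (fderiv ℝ u) x v v := by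
  have hline : ∀ t : ℝ, HasDerivAt (fun t : ℝ => x + t • v) v t := fun t => by
    simpa using ((hasDerivAt_id t).smul_const v).const_add x
  have hc : Tendsto (fun t : ℝ => x + t • v) (𝓝 0) (𝓝 x) := by
    have := (hline 0).continuousAt
    simpa [ContinuousAt] using this
  have h1 : ∀ᶠ y in 𝓝 x, DifferentiableAt ℝ u y := by
    filter_upwards [hu.eventually (by simp)] with y hy
    exact hy.differentiableAt (by norm_num)
  have h2 : deriv (fun t : ℝ => u (x + t • v)) =ᶠ[𝓝 0] fun t => fderiv ℝ u (x + t • v) v := by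
    filter_upwards [hc.eventually h1] with t ht
    exact (ht.hasFDerivAt.comp_hasDerivAt t (hline t)).deriv
  rw [h2.deriv_eq]
  have h3 : DifferentiableAt ℝ (fderiv ℝ u) x :=
    (hu.fderiv_right (m := 1) (by norm_num)).differentiableAt (by norm_num)
  have h4 : HasDerivAt (fun t : ℝ => fderiv ℝ u (x + t • v)) (fderiv ℝ (fderiv ℝ u) x v) 0 := by
    have h3' : HasFDerivAt (fderiv ℝ u) (fderiv ℝ (fderiv ℝ u) x) (x + (0 : ℝ) • v) := by
      simpa using h3.hasFDerivAt
    exact h3'.comp_hasDerivAt (0 : ℝ) (hline 0)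
  have h5 := (h4.clm_apply (hasDerivAt_const (0 : ℝ) v)).deriv
  simpa using h5

lemma differentiable_line {u : E → ℝ} {x : E} (hu : ContDiffAt ℝ 2 u x) (v : E) :
    DifferentiableAt ℝ (fun t : ℝ => u (x + t • v)) 0 := by
  have hu' : DifferentiableAt ℝ u (x + (0 : ℝ) • v) := by
    simpa using hu.differentiableAt (by norm_num)
  have : DifferentiableAt ℝ (fun t : ℝ => x + t • v) 0 := by fun_prop
  exact DifferentiableAt.comp (0 : ℝ) hu' this

lemma deriv_deriv_nonneg_of_isLocalMin {φ : ℝ → ℝ} {t : ℝ} (h : IsLocalMin φ t)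
    (hc : ContinuousAt φ t) : 0 ≤ deriv (deriv φ) t := by
  by_contra! hneg
  have hmax := isLocalMax_of_deriv_deriv_neg hneg h.deriv_eq_zero hc
  have hconst : φ =ᶠ[𝓝 t] fun _ => φ t := by
    filter_upwards [h, hmax] with y h1 h2
    exact le_antisymm h2 h1
  have h1 : deriv φ =ᶠ[𝓝 t] fun _ => 0 := by
    have := hconst.deriv
    simpa using this
  have := h1.deriv_eq
  simp at this
  linarith

lemma deriv_deriv_exp_quadratic (a b c : ℝ) :
    deriv (deriv fun t : ℝ => Real.exp (a + b * t + c * t ^ 2)) 0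
      = (2 * c + b ^ 2) * Real.exp a := by
  have h1 : ∀ t : ℝ, HasDerivAt (fun t : ℝ => Real.exp (a + b * t + c * t ^ 2))
      (Real.exp (a + b * t + c * t ^ 2) * (b + c * (2 * t))) t := fun t => by
    have h := (((hasDerivAt_id t).const_mul b).const_add a).add
      (((hasDerivAt_id t).pow 2).const_mul c)
    simpa using h.exp
  have h2 : deriv (fun t : ℝ => Real.exp (a + b * t + c * t ^ 2)) =
      fun t => Real.exp (a + b * t + c * t ^ 2) * (b + c * (2 * t)) := funext fun t => (h1 t).deriv
  rw [h2]
  have h3 : HasDerivAt (fun t : ℝ => b + c * (2 * t)) (c * 2) 0 := by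
    simpa using (((hasDerivAt_id (0:ℝ)).const_mul 2).const_mul c).const_add b
  have := ((h1 0).mul h3).deriv
  simp only [Pi.mul_def] at this
  rw [this]
  simp
  ring

end LaplacianCalculus

section Lap

variable {N : ℕ}

lemma lap_eq_sum_fderiv {u : Euc N → ℝ} {x : Euc N} (hu : ContDiffAt ℝ 2 u x) :
    lap u x = ∑ i : Fin N, fderiv ℝ (fderiv ℝ u) x (EuclideanSpace.single i 1)
      (EuclideanSpace.single i 1) := by
  have h3 : DifferentiableAt ℝ (fderiv ℝ u) x :=
    (hu.fderiv_right (m := 1) (by norm_num)).differentiableAt (by norm_num)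
  refine Finset.sum_congr rfl fun i _ => ?_
  have := (h3.hasFDerivAt.clm_apply (hasFDerivAt_const (EuclideanSpace.single i (1:ℝ)) x)).fderiv
  rw [this]
  simp

/-- The Laplacian is the sum of the second derivatives along any orthonormal frame. -/
lemma lap_eq_sum_line {u : Euc N → ℝ} {x : Euc N} (hu : ContDiffAt ℝ 2 u x)
    (b : OrthonormalBasis (Fin N) ℝ (Euc N)) :
    lap u x = ∑ i : Fin N, deriv (deriv fun t : ℝ => u (x + t • b i)) 0 := by
  have key : ∀ b : OrthonormalBasis (Fin N) ℝ (Euc N),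
      Laplacian.laplacian u x = ∑ i : Fin N, fderiv ℝ (fderiv ℝ u) x (b i) (b i) := fun b => by
    rw [InnerProductSpace.laplacian_eq_iteratedFDeriv_orthonormalBasis u b]
    simp [iteratedFDeriv_two_apply]
  simp_rw [deriv_deriv_line hu]
  rw [← key b, key (EuclideanSpace.basisFun (Fin N) ℝ), lap_eq_sum_fderiv hu]
  simp

lemma lap_eq_sum_single {u : Euc N → ℝ} {x : Euc N} (hu : ContDiffAt ℝ 2 u x) :
    lap u x = ∑ i : Fin N, deriv (deriv fun t : ℝ => u (x + t • EuclideanSpace.single i 1)) 0 := by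
  rw [lap_eq_sum_line hu (EuclideanSpace.basisFun (Fin N) ℝ)]
  simp

lemma lap_add_const_mul {u v : Euc N → ℝ} {x : Euc N} (hu : ContDiffAt ℝ 2 u x)
    (hv : ContDiffAt ℝ 2 v x) (c : ℝ) :
    lap (fun y => u y + c * v y) x = lap u x + c * lap v x := by
  have hw : ContDiffAt ℝ 2 (fun y => u y + c * v y) x := hu.add (contDiffAt_const.mul hv)
  have hd : ∀ {w : Euc N → ℝ}, ContDiffAt ℝ 2 w x → DifferentiableAt ℝ (fderiv ℝ w) x :=
    fun {w} h => (ContDiffAt.fderiv_right (f := w) (m := 1) h (by norm_num)).differentiableAt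
      (by norm_num)
  have hev : ∀ {w : Euc N → ℝ}, ContDiffAt ℝ 2 w x → ∀ᶠ y in 𝓝 x, DifferentiableAt ℝ w y := by
    intro w hw
    filter_upwards [hw.eventually (by simp)] with y hy
    exact hy.differentiableAt (by norm_num)
  rw [lap_eq_sum_fderiv hw, lap_eq_sum_fderiv hu, lap_eq_sum_fderiv hv, Finset.mul_sum,
    ← Finset.sum_add_distrib]
  have h1 : fderiv ℝ (fun y => u y + c * v y) =ᶠ[𝓝 x]
      fun y => fderiv ℝ u y + c • fderiv ℝ v y := by
    filter_upwards [hev hu, hev hv] with y h1 h2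
    exact (h1.hasFDerivAt.add (h2.hasFDerivAt.const_mul c)).fderiv
  have h2 := ((hd hu).hasFDerivAt.add ((hd hv).hasFDerivAt.const_smul c)).fderiv
  refine Finset.sum_congr rfl fun i _ => ?_
  rw [h1.fderiv_eq]
  have : (fun y => fderiv ℝ u y + c • fderiv ℝ v y) = (fderiv ℝ u + c • fderiv ℝ v) := rfl
  rw [this, h2]
  simp

lemma lap_nonneg_of_isLocalMin {u : Euc N → ℝ} {x : Euc N} (hu : ContDiffAt ℝ 2 u x)
    (h : IsLocalMin u x) : 0 ≤ lap u x := by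
  rw [lap_eq_sum_single hu]
  refine Finset.sum_nonneg fun i _ => ?_
  have hd := (differentiable_line hu (EuclideanSpace.single i (1:ℝ))).continuousAt
  refine deriv_deriv_nonneg_of_isLocalMin ?_ hd
  have hc : Tendsto (fun t : ℝ => x + t • EuclideanSpace.single i (1:ℝ)) (𝓝 0) (𝓝 x) := by
    have : Continuous (fun t : ℝ => x + t • EuclideanSpace.single i (1:ℝ)) := by fun_prop
    simpa using this.tendsto 0
  have := hc.eventually h
  simpa [IsLocalMin, IsMinFilter] using this

/-- The Laplacian commutes with affine isometries. -/
lemma lap_comp_isometry {u : Euc N → ℝ} {x : Euc N} (A : Euc N ≃ₗᵢ[ℝ] Euc N) (c : Euc N)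
    (hu : ContDiffAt ℝ 2 u (A x + c)) :
    lap (fun y => u (A y + c)) x = lap u (A x + c) := by
  have hg : ContDiffAt ℝ 2 (fun y => A y + c) x :=
    (A.contDiff.contDiffAt).add contDiffAt_const
  have hw : ContDiffAt ℝ 2 (fun y => u (A y + c)) x := ContDiffAt.comp x hu hg
  rw [lap_eq_sum_single hw, lap_eq_sum_line hu ((EuclideanSpace.basisFun (Fin N) ℝ).map A)]
  refine Finset.sum_congr rfl fun i _ => ?_
  congr 2
  ext t
  simp [add_right_comm]

lemma lap_congr {u v : Euc N → ℝ} {x : Euc N} (h : u =ᶠ[𝓝 x] v) : lap u x = lap v x := by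
  refine Finset.sum_congr rfl fun i _ => ?_
  have h1 : (fun y => fderiv ℝ u y (EuclideanSpace.single i 1)) =ᶠ[𝓝 x]
      (fun y => fderiv ℝ v y (EuclideanSpace.single i 1)) := by
    filter_upwards [(h.fderiv : fderiv ℝ u =ᶠ[𝓝 x] fderiv ℝ v)] with y hy
    rw [hy]
  rw [h1.fderiv_eq]

/-- The Laplacian of a Gaussian. -/
lemma lap_gaussian (κ : ℝ) (z x : Euc 2) :
    lap (fun y => Real.exp (-κ * ‖y - z‖ ^ 2)) x
      = (4 * κ ^ 2 * ‖x - z‖ ^ 2 - 4 * κ) * Real.exp (-κ * ‖x - z‖ ^ 2) := by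
  have hu : ContDiffAt ℝ 2 (fun y : Euc 2 => Real.exp (-κ * ‖y - z‖ ^ 2)) x := by
    refine ContDiff.contDiffAt ?_
    exact Real.contDiff_exp.comp (contDiff_const.mul
      ((contDiff_id.sub contDiff_const).norm_sq ℝ))
  rw [lap_eq_sum_single hu]
  have hi : ∀ i : Fin 2, deriv (deriv fun t : ℝ =>
      Real.exp (-κ * ‖x + t • EuclideanSpace.single i (1:ℝ) - z‖ ^ 2)) 0
      = (2 * (-κ) + (-2 * κ * (x - z) i) ^ 2) * Real.exp (-κ * ‖x - z‖ ^ 2) := fun i => by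
    rw [← deriv_deriv_exp_quadratic]
    congr 2
    ext t
    have : x + t • EuclideanSpace.single i (1:ℝ) - z
        = (x - z) + t • EuclideanSpace.single i (1:ℝ) := by abel
    rw [this, norm_add_sq_real, inner_smul_right, norm_smul]
    simp [EuclideanSpace.inner_single_right]
    ring
  simp_rw [hi]
  rw [Fin.sum_univ_two, EuclideanSpace.norm_sq_eq (x - z), Fin.sum_univ_two]
  simp only [Real.norm_eq_abs, sq_abs]
  ring

lemma lap_exp_inner (κ l : ℝ) (e x : Euc 2) (he : ‖e‖ = 1) :
    lap (fun y => Real.exp (-κ * (inner ℝ y e - l))) x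
      = κ ^ 2 * Real.exp (-κ * (inner ℝ x e - l)) := by
  have hu : ContDiffAt ℝ 2 (fun y : Euc 2 => Real.exp (-κ * (inner ℝ y e - l))) x := by
    refine ContDiff.contDiffAt ?_
    exact Real.contDiff_exp.comp (contDiff_const.mul
      ((contDiff_id.inner ℝ contDiff_const).sub contDiff_const))
  rw [lap_eq_sum_single hu]
  have hi : ∀ i : Fin 2, deriv (deriv fun t : ℝ =>
      Real.exp (-κ * (inner ℝ (x + t • EuclideanSpace.single i (1:ℝ)) e - l))) 0
      = (2 * 0 + (-κ * e i) ^ 2) * Real.exp (-κ * (inner ℝ x e - l)) := fun i => by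
    rw [← deriv_deriv_exp_quadratic]
    congr 2
    ext t
    rw [inner_add_left, inner_smul_left]
    simp [EuclideanSpace.inner_single_left]
    ring
  simp_rw [hi]
  have h1 : ‖e‖ ^ 2 = 1 := by rw [he]; norm_num
  rw [EuclideanSpace.norm_sq_eq e, Fin.sum_univ_two] at h1
  simp only [Real.norm_eq_abs, sq_abs] at h1
  rw [Fin.sum_univ_two]
  linear_combination κ ^ 2 * Real.exp (-κ * (inner ℝ x e - l)) * h1

end Lap

/-- A nonnegative superharmonic function that is positive at the centre of a disc is positive in
the whole disc. -/
lemma pos_on_ball_of_superharmonic {W : Euc 2 → ℝ} {z : Euc 2} {R : ℝ}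
    (hc : ContinuousOn W (Metric.closedBall z R))
    (h2 : ∀ x ∈ Metric.ball z R, ContDiffAt ℝ 2 W x)
    (h0 : ∀ x ∈ Metric.closedBall z R, 0 ≤ W x)
    (hl : ∀ x ∈ Metric.ball z R, lap W x ≤ 0) (hz : 0 < W z) :
    ∀ x ∈ Metric.ball z R, 0 < W x := by
  intro y hy
  have hR : 0 < R := Metric.pos_of_mem_ball hy
  have hzc : ContinuousAt W z := hc.continuousAt (Metric.closedBall_mem_nhds z hR)
  obtain ⟨ρ, hρ, hρW⟩ : ∃ ρ > 0, ∀ x ∈ Metric.closedBall z ρ, W z / 2 < W x := by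
    have := hzc.eventually (lt_mem_nhds (half_lt_self hz))
    obtain ⟨ε, hε, h⟩ := Metric.nhds_basis_closedBall.eventually_iff.1 this
    exact ⟨ε, hε, fun x hx => h hx⟩
  set m := W z / 2 with hm
  have hm0 : 0 < m := half_pos hz
  by_cases hyρ : y ∈ Metric.closedBall z ρ
  · exact hm0.trans (hρW y hyρ)
  set κ := 2 / ρ ^ 2 with hκ
  have hκ0 : 0 < κ := by positivity
  set A := Metric.closedBall z R \ Metric.ball z ρ with hA
  have hAc : IsCompact A := (isCompact_closedBall z R).diff Metric.isOpen_ball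
  have hyA : y ∈ A := ⟨Metric.ball_subset_closedBall hy,
    fun h => hyρ (Metric.ball_subset_closedBall h)⟩
  set h : Euc 2 → ℝ := fun x => Real.exp (-κ * ‖x - z‖ ^ 2) with hh
  have hhs : ContDiff ℝ 2 h := Real.contDiff_exp.comp (contDiff_const.mul
      ((contDiff_id.sub contDiff_const).norm_sq ℝ))
  set V : Euc 2 → ℝ := fun x => W x + (-m) * h x with hV
  have hVc : ContinuousOn V A := (hc.mono sdiff_subset).add
    (continuousOn_const.mul hhs.continuous.continuousOn)
  obtain ⟨x0, hx0A, hx0⟩ := hAc.exists_isMinOn ⟨y, hyA⟩ hVc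
  have hVy : V x0 ≤ V y := hx0 hyA
  have hkey : -m * Real.exp (-κ * R ^ 2) ≤ V x0 := by
    have hdR : ‖x0 - z‖ ≤ R := by simpa [dist_eq_norm] using hx0A.1
    have hdρ : ρ ≤ ‖x0 - z‖ := by simpa [dist_eq_norm] using hx0A.2
    rcases eq_or_lt_of_le hdR with hR' | hR'
    · have := h0 x0 hx0A.1
      simp only [hV, hh, hR']
      linarith
    rcases eq_or_lt_of_le hdρ with hρ' | hρ'
    · have h1 := hρW x0 (by simp [dist_eq_norm, ← hρ'])
      have h2 : h x0 ≤ 1 := by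
        simp only [hh, Real.exp_le_one_iff]
        have : 0 ≤ κ * ‖x0 - z‖ ^ 2 := by positivity
        linarith
      have h3 := Real.exp_pos (-κ * R ^ 2)
      simp only [hV]
      nlinarith
    · exfalso
      have hmem : A ∈ 𝓝 x0 := by
        have h1 : Metric.ball z R ∩ (Metric.closedBall z ρ)ᶜ ∈ 𝓝 x0 := by
          refine (Metric.isOpen_ball.inter Metric.isClosed_closedBall.isOpen_compl).mem_nhds ?_
          simp [dist_eq_norm, hR', hρ']
        refine mem_of_superset h1 fun x hx => ⟨Metric.ball_subset_closedBall hx.1, fun h => hx.2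
          (Metric.ball_subset_closedBall h)⟩
      have hloc : IsLocalMin V x0 := hx0.isLocalMin hmem
      have hb : x0 ∈ Metric.ball z R := by simp [dist_eq_norm, hR']
      have hW2 := h2 x0 hb
      have hnn := lap_nonneg_of_isLocalMin (hW2.add (contDiffAt_const.mul hhs.contDiffAt)) hloc
      rw [lap_add_const_mul hW2 hhs.contDiffAt, hh, lap_gaussian] at hnn
      have hl0 := hl x0 hb
      have hpos : 0 < 4 * κ ^ 2 * ‖x0 - z‖ ^ 2 - 4 * κ := by
        have h1 : κ * ρ ^ 2 = 2 := by rw [hκ]; field_simp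
        have h2 : ρ ^ 2 ≤ ‖x0 - z‖ ^ 2 := by gcongr
        have h3 : 2 ≤ κ * ‖x0 - z‖ ^ 2 := by rw [← h1]; gcongr
        nlinarith
      have := mul_pos hm0 (mul_pos hpos (Real.exp_pos (-κ * ‖x0 - z‖ ^ 2)))
      linarith
  have hyR : ‖y - z‖ < R := by simpa [dist_eq_norm] using hy
  have hexp : Real.exp (-κ * R ^ 2) < h y := by
    simp only [hh, Real.exp_lt_exp]
    have : ‖y - z‖ ^ 2 < R ^ 2 := by gcongr
    nlinarith
  have : V y = W y + (-m) * h y := rfl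
  nlinarith

/-- Strong minimum principle: a nonnegative superharmonic function on a connected open subset
of the plane that vanishes somewhere vanishes identically. -/
lemma eq_zero_of_superharmonic {W : Euc 2 → ℝ} {S : Set (Euc 2)} (hS : IsOpen S)
    (hconn : IsPreconnected S) (h2 : ∀ x ∈ S, ContDiffAt ℝ 2 W x) (h0 : ∀ x ∈ S, 0 ≤ W x)
    (hl : ∀ x ∈ S, lap W x ≤ 0) {x0 : Euc 2} (hx0 : x0 ∈ S) (hW : W x0 = 0) :
    ∀ x ∈ S, W x = 0 := by
  by_contra! hcon
  obtain ⟨z, hzS, hz⟩ := hcon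
  have hWc : ContinuousOn W S := fun x hx => (h2 x hx).continuousAt.continuousWithinAt
  set P := S ∩ W ⁻¹' Ioi 0 with hP
  have hPo : IsOpen P := hWc.isOpen_inter_preimage hS isOpen_Ioi
  have hsub : S ⊆ P := by
    refine hconn.subset_of_closure_inter_subset hPo
      ⟨z, hzS, hzS, lt_of_le_of_ne (h0 z hzS) (Ne.symm hz)⟩ ?_
    rintro x ⟨hxc, hxS⟩
    obtain ⟨r, hr, hrS⟩ := Metric.isOpen_iff.1 hS x hxS
    obtain ⟨y, hyP, hxy⟩ := Metric.mem_closure_iff.1 hxc (r / 3) (by positivity)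
    have hsub : Metric.closedBall y (r / 2) ⊆ S := fun w hw => hrS <| by
      rw [Metric.mem_closedBall] at hw
      rw [Metric.mem_ball]
      have := dist_triangle w y x
      rw [dist_comm y x] at this
      linarith
    have hb := Metric.ball_subset_closedBall (x := y) (ε := r / 2)
    refine ⟨hxS, pos_on_ball_of_superharmonic (R := r / 2) (hWc.mono hsub)
      (fun w hw => h2 w (hsub (hb hw))) (fun w hw => h0 w (hsub hw))
      (fun w hw => hl w (hsub (hb hw))) hyP.2 x ?_⟩
    rw [Metric.mem_ball]
    linarith
  have := (hsub hx0).2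
  simp [hW] at this

/-- The linear reflection across the line orthogonal to `e`. -/
def refl2 (e : Euc 2) : Euc 2 ≃ₗᵢ[ℝ] Euc 2 := (ℝ ∙ e)ᗮ.reflection

lemma refl2_apply {e : Euc 2} (he : ‖e‖ = 1) (x : Euc 2) :
    refl2 e x = x - (2 * inner ℝ x e) • e := by
  rw [refl2, Submodule.reflection_orthogonal_apply, Submodule.reflection_singleton_apply]
  simp only [he, real_inner_comm]
  simp [mul_smul, two_smul]

lemma norm_sq_refl2_add {e : Euc 2} (he : ‖e‖ = 1) (l : ℝ) (x : Euc 2) :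
    ‖refl2 e x + (2 * l) • e‖ ^ 2 = ‖x‖ ^ 2 - 4 * l * (inner ℝ x e - l) := by
  have h1 : refl2 e x + (2 * l) • e = x + (2 * (l - inner ℝ x e)) • e := by
    rw [refl2_apply he, sub_add, ← sub_smul, sub_eq_add_neg, ← neg_smul]
    congr 2; ring
  rw [h1, norm_add_sq_real, inner_smul_right, norm_smul, he, mul_one, Real.norm_eq_abs, sq_abs]
  ring

/-- Structural hypotheses on a solution of `-Δu = f(|x|, u)` in the unit disc, extended by zero,
under which the moving plane method applies. -/
structure PlaneSetup (f : ℝ → ℝ → ℝ) (u : Euc 2 → ℝ) : Prop where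
  anti : ∀ r r' t, 0 ≤ r → r ≤ r' → r' ≤ 1 → 0 < t → f r' t ≤ f r t
  mono : ∀ r t t', 0 ≤ r → r ≤ 1 → 0 < t → t ≤ t' → f r t ≤ f r t'
  lip : ∀ M, ∃ L, ∀ r t t', 0 ≤ r → r ≤ 1 → 0 < t → t ≤ t' → t' ≤ M →
    f r t' - f r t ≤ L * (t' - t)
  cont : Continuous u
  smooth : ∀ x, ‖x‖ < 1 → ContDiffAt ℝ 2 u x
  pos : ∀ x, ‖x‖ < 1 → 0 < u x
  zero : ∀ x, 1 ≤ ‖x‖ → u x = 0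
  eq : ∀ x, ‖x‖ < 1 → lap u x = - f ‖x‖ (u x)

/-- The difference between the reflection of `u` across `{⟨x, e⟩ = l}` and `u`. -/
def planeDiff (u : Euc 2 → ℝ) (e : Euc 2) (l : ℝ) (x : Euc 2) : ℝ :=
  u (refl2 e x + (2 * l) • e) + (-1) * u x

namespace PlaneSetup

variable {f : ℝ → ℝ → ℝ} {u : Euc 2 → ℝ} {e : Euc 2}

lemma nonneg (h : PlaneSetup f u) (x : Euc 2) : 0 ≤ u x := by
  rcases lt_or_ge ‖x‖ 1 with hx | hx
  · exact (h.pos x hx).le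
  · exact (h.zero x hx).ge

lemma norm_refl_le (he : ‖e‖ = 1) {l : ℝ} {x : Euc 2} (hl : 0 ≤ l) (hx : l ≤ inner ℝ x e) :
    ‖refl2 e x + (2 * l) • e‖ ≤ ‖x‖ := by
  have := norm_sq_refl2_add he l x
  refine le_of_sq_le_sq ?_ (norm_nonneg x)
  have h2 : 0 ≤ l * (inner ℝ x e - l) := mul_nonneg hl (by linarith)
  linarith

lemma norm_refl_lt (he : ‖e‖ = 1) {l : ℝ} {x : Euc 2} (hl : 0 < l) (hx : l < inner ℝ x e) :
    ‖refl2 e x + (2 * l) • e‖ < ‖x‖ := by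
  have := norm_sq_refl2_add he l x
  refine lt_of_pow_lt_pow_left₀ 2 (norm_nonneg x) ?_
  have h2 : 0 < l * (inner ℝ x e - l) := mul_pos hl (by linarith)
  linarith

lemma contDiffAt_planeDiff (h : PlaneSetup f u) (he : ‖e‖ = 1) {l : ℝ} {x : Euc 2} (hl : 0 ≤ l)
    (hx : l ≤ inner ℝ x e) (hx1 : ‖x‖ < 1) : ContDiffAt ℝ 2 (planeDiff u e l) x := by
  have h1 := h.smooth _ ((norm_refl_le he hl hx).trans_lt hx1)
  have hg : ContDiffAt ℝ 2 (fun y => refl2 e y + (2 * l) • e) x :=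
    ((refl2 e).contDiff.contDiffAt).add contDiffAt_const
  exact (ContDiffAt.comp x h1 hg).add (contDiffAt_const.mul (h.smooth x hx1))

lemma lap_planeDiff (h : PlaneSetup f u) (he : ‖e‖ = 1) {l : ℝ} {x : Euc 2} (hl : 0 ≤ l)
    (hx : l ≤ inner ℝ x e) (hx1 : ‖x‖ < 1) :
    lap (planeDiff u e l) x ≤ f ‖x‖ (u x) - f ‖x‖ (u (refl2 e x + (2 * l) • e)) := by
  have hn := norm_refl_le he hl hx
  have h1 := h.smooth _ (hn.trans_lt hx1)
  have hg : ContDiffAt ℝ 2 (fun y => refl2 e y + (2 * l) • e) x :=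
    ((refl2 e).contDiff.contDiffAt).add contDiffAt_const
  have := lap_add_const_mul (u := fun y => u (refl2 e y + (2 * l) • e))
    (ContDiffAt.comp x h1 hg) (h.smooth x hx1) (-1)
  rw [lap_comp_isometry _ _ h1, h.eq x hx1, h.eq _ (hn.trans_lt hx1)] at this
  have h3 := h.anti _ _ (u (refl2 e x + (2 * l) • e)) (norm_nonneg _) hn hx1.le
    (h.pos _ (hn.trans_lt hx1))
  unfold planeDiff
  linarith

lemma continuous_planeDiff (h : PlaneSetup f u) {X : Type*} [TopologicalSpace X] {a : X → ℝ}
    {b : X → Euc 2} (ha : Continuous a) (hb : Continuous b) :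
    Continuous fun z => planeDiff u e (a z) (b z) := by
  have := h.cont
  have h2 := (refl2 e).continuous
  unfold planeDiff
  fun_prop

lemma planeDiff_eq_zero (he : ‖e‖ = 1) {l : ℝ} {x : Euc 2} (hx : inner ℝ x e = l) :
    planeDiff u e l x = 0 := by
  have : refl2 e x + (2 * l) • e = x := by rw [refl2_apply he, hx]; simp
  simp [planeDiff, this]

set_option maxHeartbeats 400000 in
/-- Negativity of the plane difference propagates to a definite distance from the plane. -/
lemma exists_neg_far (h : PlaneSetup f u) (he : ‖e‖ = 1) :
    ∃ δ > 0, ∀ l x, 0 ≤ l → ‖x‖ ≤ 1 → l ≤ inner ℝ x e → planeDiff u e l x < 0 →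
      ∃ y, ‖y‖ ≤ 1 ∧ l + δ ≤ inner ℝ y e ∧ planeDiff u e l y < 0 := by
  obtain ⟨M, hM⟩ : ∃ M, ∀ x : Euc 2, ‖x‖ ≤ 1 → u x ≤ M := by
    obtain ⟨M, hM⟩ := (isCompact_closedBall (0 : Euc 2) 1).bddAbove_image h.cont.continuousOn
    exact ⟨M, fun x hx => hM ⟨x, by simpa using hx, rfl⟩⟩
  obtain ⟨L, hL⟩ := h.lip M
  set κ := 2 * Real.exp 1 * (|L| + 1) with hκ
  have hκ0 : 0 < κ := by positivity
  refine ⟨1 / κ, by positivity, fun l x hl hx1 hxl hneg => ?_⟩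
  set C : Set (Euc 2) := Metric.closedBall 0 1 ∩ {x | l ≤ inner ℝ x e} with hC
  have hCc : IsCompact C := (isCompact_closedBall _ _).inter_right
    (isClosed_le continuous_const (by fun_prop))
  have hxC : x ∈ C := ⟨by simpa using hx1, hxl⟩
  set E : Euc 2 → ℝ := fun y => Real.exp (-κ * (inner ℝ y e - l)) with hE
  have hEs : ContDiff ℝ 2 E := Real.contDiff_exp.comp (contDiff_const.mul
      ((contDiff_id.inner ℝ contDiff_const).sub contDiff_const))
  have hE1 : ∀ y ∈ C, E y ≤ 1 := fun y hy => by
    simp only [hE, Real.exp_le_one_iff]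
    have : 0 ≤ κ * (inner ℝ y e - l) := mul_nonneg hκ0.le (by linarith [hy.2.out])
    linarith
  have hWc : Continuous (planeDiff u e l) :=
    h.continuous_planeDiff continuous_const continuous_id
  have hQc : ContinuousOn (fun y => planeDiff u e l y / (2 - E y)) C :=
    hWc.continuousOn.div (continuousOn_const.sub hEs.continuous.continuousOn)
      fun y hy => by linarith [hE1 y hy]
  obtain ⟨x0, hx0C, hx0⟩ := hCc.exists_isMinOn ⟨x, hxC⟩ hQc
  have hgpos : ∀ y ∈ C, 0 < 2 - E y := fun y hy => by linarith [hE1 y hy]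
  set m := - (planeDiff u e l x0 / (2 - E x0)) with hm
  have hm0 : 0 < m := by
    have h1 : planeDiff u e l x0 / (2 - E x0) ≤ planeDiff u e l x / (2 - E x) := hx0 hxC
    have h2 := div_neg_of_neg_of_pos hneg (hgpos x hxC)
    linarith
  have hW0 : planeDiff u e l x0 = - m * (2 - E x0) := by
    rw [hm, neg_neg, div_mul_cancel₀ _ (hgpos x0 hx0C).ne']
  have hW0neg : planeDiff u e l x0 < 0 := by
    rw [hW0]; have := mul_pos hm0 (hgpos x0 hx0C); linarith
  have hn1 : ‖x0‖ ≤ 1 := by simpa using hx0C.1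
  by_contra! hcon
  have hfar : inner ℝ x0 e < l + 1 / κ := by
    by_contra! hge
    exact absurd (hcon x0 hn1 hge) (not_le.2 hW0neg)
  have hnear : l < inner ℝ x0 e := by
    refine lt_of_le_of_ne hx0C.2 fun heq => ?_
    rw [planeDiff_eq_zero he heq.symm] at hW0neg
    exact lt_irrefl _ hW0neg
  have hlt1 : ‖x0‖ < 1 := by
    refine lt_of_le_of_ne hn1 fun heq => ?_
    have h1 := h.nonneg (refl2 e x0 + (2 * l) • e)
    have h2 := h.zero x0 heq.ge
    simp only [planeDiff, h2] at hW0neg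
    linarith
  have hmem : C ∈ 𝓝 x0 := by
    have h1 : Metric.ball 0 1 ∩ {x : Euc 2 | l < inner ℝ x e} ∈ 𝓝 x0 :=
      (Metric.isOpen_ball.inter (isOpen_lt continuous_const (by fun_prop))).mem_nhds
        ⟨by simpa using hlt1, hnear⟩
    exact mem_of_superset h1 fun y hy => ⟨Metric.ball_subset_closedBall hy.1, hy.2.out.le⟩
  have hloc : IsLocalMin (fun y => planeDiff u e l y + (-m) * E y) x0 := by
    filter_upwards [hmem] with y hy
    have h1 : planeDiff u e l x0 / (2 - E x0) ≤ planeDiff u e l y / (2 - E y) := hx0 hy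
    rw [le_div_iff₀ (hgpos y hy)] at h1
    have h3 : planeDiff u e l x0 / (2 - E x0) = -m := by rw [hm, neg_neg]
    rw [h3] at h1
    rw [hW0]
    linarith
  have hs := h.contDiffAt_planeDiff he hl hx0C.2 hlt1
  have hnn := lap_nonneg_of_isLocalMin (hs.add (contDiffAt_const.mul hEs.contDiffAt)) hloc
  rw [lap_add_const_mul hs hEs.contDiffAt, hE, lap_exp_inner κ l e x0 he] at hnn
  have hlapW := h.lap_planeDiff he hl hx0C.2 hlt1
  have hrlt := (norm_refl_le he hl hx0C.2).trans_lt hlt1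
  have hWdef : planeDiff u e l x0 = u (refl2 e x0 + (2 * l) • e) + (-1) * u x0 := rfl
  have hlip := hL ‖x0‖ (u (refl2 e x0 + (2 * l) • e)) (u x0) (norm_nonneg _) hn1
    (h.pos _ hrlt) (by linarith) (hM x0 hn1)
  have hd : u x0 - u (refl2 e x0 + (2 * l) • e) = m * (2 - E x0) := by linarith
  have hEpos : 0 < E x0 := Real.exp_pos _
  have hd2 : L * (u x0 - u (refl2 e x0 + (2 * l) • e)) ≤ |L| * (m * 2) := by
    rw [hd]
    refine mul_le_mul (le_abs_self L) ?_ (mul_nonneg hm0.le (hgpos x0 hx0C).le) (abs_nonneg L)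
    nlinarith
  have hElow : Real.exp (-1) ≤ Real.exp (-κ * (inner ℝ x0 e - l)) := by
    rw [Real.exp_le_exp]
    have : κ * (inner ℝ x0 e - l) ≤ κ * (1 / κ) := by gcongr; linarith
    rw [mul_one_div_cancel hκ0.ne'] at this
    linarith
  have hfin : 2 * |L| + 2 ≤ κ ^ 2 * Real.exp (-κ * (inner ℝ x0 e - l)) := by
    have h1 : κ ^ 2 * Real.exp (-1) ≤ κ ^ 2 * Real.exp (-κ * (inner ℝ x0 e - l)) := by gcongr
    have h2 : κ ^ 2 * Real.exp (-1) = 2 * (|L| + 1) * κ := by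
      have : Real.exp 1 * Real.exp (-1) = 1 := by rw [← Real.exp_add]; simp
      calc κ ^ 2 * Real.exp (-1) = 2 * (|L| + 1) * κ * (Real.exp 1 * Real.exp (-1)) := by
            rw [hκ]; ring
        _ = _ := by rw [this, mul_one]
    have h3 : 1 ≤ κ := by
      have : 1 ≤ Real.exp 1 := Real.one_le_exp (by norm_num)
      have := abs_nonneg L
      nlinarith
    have := abs_nonneg L
    nlinarith
  nlinarith

set_option maxHeartbeats 400000 in
lemma planeDiff_nonneg (h : PlaneSetup f u) (he : ‖e‖ = 1) {l : ℝ} (hl : 0 < l) {x : Euc 2}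
    (hx1 : ‖x‖ ≤ 1) (hxl : l ≤ inner ℝ x e) : 0 ≤ planeDiff u e l x := by
  by_contra! hneg
  obtain ⟨δ, hδ, hfar⟩ := h.exists_neg_far he
  have hinner : ∀ y : Euc 2, inner ℝ y e ≤ ‖y‖ := fun y => by
    simpa [he] using real_inner_le_norm y e
  set Z : Set (ℝ × Euc 2) := (Icc l 1 ×ˢ Metric.closedBall 0 1) ∩
    {z | z.1 + δ ≤ inner ℝ z.2 e ∧ planeDiff u e z.1 z.2 ≤ 0} with hZ
  have hZc : IsCompact Z := by
    refine (isCompact_Icc.prod (isCompact_closedBall _ _)).inter_right ?_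
    have h1 : IsClosed {z : ℝ × Euc 2 | z.1 + δ ≤ inner ℝ z.2 e} :=
      isClosed_le (by fun_prop) (by fun_prop)
    have h2 : IsClosed {z : ℝ × Euc 2 | planeDiff u e z.1 z.2 ≤ 0} :=
      isClosed_le (h.continuous_planeDiff continuous_fst continuous_snd) continuous_const
    exact h1.inter h2
  have hTc : IsCompact (Prod.fst '' Z) := hZc.image continuous_fst
  have hstart : ∀ l' y, l ≤ l' → ‖y‖ ≤ 1 → l' ≤ inner ℝ y e → planeDiff u e l' y < 0 →
      l' ∈ Prod.fst '' Z := by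
    intro l' y hl' hy1 hyl hyneg
    obtain ⟨w, hw1, hwl, hwneg⟩ := hfar l' y (hl.le.trans hl') hy1 hyl hyneg
    exact ⟨(l', w), ⟨⟨⟨hl', (hyl.trans (hinner y)).trans hy1⟩, by simpa using hw1⟩,
      hwl, hwneg.le⟩, rfl⟩
  obtain ⟨l₀, ⟨⟨l₁, x₀⟩, hz, rfl⟩, hmax⟩ :=
    hTc.exists_isGreatest ⟨l, hstart l x le_rfl hx1 hxl hneg⟩
  obtain ⟨⟨⟨hl₁, -⟩, hx₀⟩, hx₀l, hx₀W⟩ := hz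
  dsimp only at hl₁ hx₀ hx₀l hx₀W hmax
  have hx₀1 : ‖x₀‖ ≤ 1 := by simpa using hx₀
  have hl₁0 : 0 < l₁ := hl.trans_le hl₁
  have hl₁1 : l₁ < 1 := by linarith [hinner x₀]
  set S : Set (Euc 2) := Metric.ball 0 1 ∩ {y | l₁ < inner ℝ y e} with hS
  have hSo : IsOpen S := Metric.isOpen_ball.inter (isOpen_lt continuous_const (by fun_prop))
  have hSconv : Convex ℝ S := by
    refine (convex_ball _ _).inter ?_
    have := convex_halfSpace_gt (f := fun y : Euc 2 => inner ℝ y e)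
      ⟨fun a b => inner_add_left a b e, fun c a => real_inner_smul_left a e c⟩ l₁
    exact this
  have hnn : ∀ y ∈ S, 0 ≤ planeDiff u e l₁ y := by
    intro y hy
    have hy1 : ‖y‖ < 1 := by simpa using hy.1
    have hc : Tendsto (fun t => planeDiff u e t y) (𝓝[>] l₁) (𝓝 (planeDiff u e l₁ y)) :=
      ((h.continuous_planeDiff continuous_id continuous_const).tendsto l₁).mono_left nhdsWithin_le_nhds
    refine ge_of_tendsto hc ?_
    filter_upwards [Ioo_mem_nhdsGT hy.2.out] with t ht
    by_contra! hlt
    have := hmax (hstart t y (hl₁.trans ht.1.le) hy1.le ht.2.le hlt)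
    exact absurd this (not_le.2 ht.1)
  have hS1 : ∀ y ∈ S, ‖y‖ < 1 := fun y hy => by simpa using hy.1
  have hx₀lt : ‖x₀‖ < 1 := by
    refine lt_of_le_of_ne hx₀1 fun heq => ?_
    have h1 := h.pos _ ((norm_refl_lt he hl₁0 (by linarith : l₁ < inner ℝ x₀ e)).trans_le hx₀1)
    have h2 := h.zero x₀ heq.ge
    simp only [planeDiff, h2] at hx₀W
    linarith
  have hx₀S : x₀ ∈ S := ⟨by simpa using hx₀lt, by
    have : l₁ < inner ℝ x₀ e := by linarith
    exact this⟩
  have hzero := eq_zero_of_superharmonic (W := planeDiff u e l₁) hSo hSconv.isPreconnected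
    (fun y hy => h.contDiffAt_planeDiff he hl₁0.le hy.2.out.le (hS1 y hy)) hnn
    (fun y hy => by
      have h1 := h.lap_planeDiff he hl₁0.le hy.2.out.le (hS1 y hy)
      have h2 := hnn y hy
      have h3 := h.mono ‖y‖ (u y) (u (refl2 e y + (2 * l₁) • e)) (norm_nonneg _) (hS1 y hy).le
        (h.pos y (hS1 y hy)) (by simp only [planeDiff] at h2; linarith)
      linarith) hx₀S (le_antisymm hx₀W (hnn x₀ hx₀S))
  have hce : Tendsto (fun t : ℝ => planeDiff u e l₁ (t • e)) (𝓝[<] 1)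
      (𝓝 (planeDiff u e l₁ ((1 : ℝ) • e))) := by
    have h1 : Continuous (fun t : ℝ => planeDiff u e l₁ (t • e)) :=
      h.continuous_planeDiff continuous_const (by fun_prop)
    exact (h1.tendsto 1).mono_left nhdsWithin_le_nhds
  have hze : planeDiff u e l₁ ((1 : ℝ) • e) = 0 := by
    refine tendsto_nhds_unique hce (tendsto_const_nhds.congr' ?_)
    filter_upwards [Ioo_mem_nhdsLT hl₁1] with t ht
    refine (hzero _ ⟨?_, ?_⟩).symm
    · have : |t| < 1 := by rw [abs_of_pos (hl₁0.trans ht.1)]; exact ht.2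
      simpa [norm_smul, he] using this
    · have : l₁ < inner ℝ (t • e) e := by
        rw [inner_smul_left, real_inner_self_eq_norm_sq, he]; simpa using ht.1
      exact this
  rw [one_smul] at hze
  have hee : l₁ < inner ℝ e e := by rw [real_inner_self_eq_norm_sq, he]; simpa using hl₁1
  have h1 := h.pos _ ((norm_refl_lt he hl₁0 hee).trans_le he.le)
  have h2 := h.zero e he.ge
  simp only [planeDiff, h2] at hze
  linarith

lemma le_comp_refl (h : PlaneSetup f u) (he : ‖e‖ = 1) {x : Euc 2} (hx1 : ‖x‖ ≤ 1)
    (hx : 0 < inner ℝ x e) : u x ≤ u (refl2 e x) := by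
  have hc : Tendsto (fun t => planeDiff u e t x) (𝓝[>] 0) (𝓝 (planeDiff u e 0 x)) :=
    ((h.continuous_planeDiff continuous_id continuous_const).tendsto 0).mono_left
      nhdsWithin_le_nhds
  have : 0 ≤ planeDiff u e 0 x := by
    refine ge_of_tendsto hc ?_
    filter_upwards [Ioo_mem_nhdsGT hx] with t ht
    exact h.planeDiff_nonneg he ht.1 hx1 ht.2.le
  simp only [planeDiff, mul_zero, zero_smul, add_zero] at this
  linarith

/-- Radial symmetry by the method of moving planes. -/
theorem radial (h : PlaneSetup f u) {x y : Euc 2} (hxy : ‖x‖ = ‖y‖) (hx1 : ‖x‖ ≤ 1) :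
    u x = u y := by
  have key : ∀ x y : Euc 2, ‖x‖ = ‖y‖ → ‖x‖ ≤ 1 → x ≠ y → u x ≤ u y := by
    intro x y hxy hx1 hne
    have hd : 0 < ‖x - y‖ := norm_pos_iff.2 (sub_ne_zero.2 hne)
    set e := ‖x - y‖⁻¹ • (x - y) with he
    have he1 : ‖e‖ = 1 := by
      rw [he, norm_smul, norm_inv, norm_norm, inv_mul_cancel₀ hd.ne']
    have hin : 2 * inner ℝ x (x - y) = ‖x - y‖ ^ 2 := by
      rw [norm_sub_sq_real, inner_sub_right, real_inner_self_eq_norm_sq, hxy]; ring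
    have hxe : 2 * inner ℝ x e = ‖x - y‖ := by
      rw [he, inner_smul_right]
      field_simp
      linarith
    have h1 := h.le_comp_refl he1 hx1 (by linarith)
    rwa [refl2_apply he1, hxe, he, smul_smul, mul_inv_cancel₀ hd.ne', one_smul,
      sub_sub_cancel] at h1
  by_cases hne : x = y
  · rw [hne]
  · exact le_antisymm (key x y hxy hx1 hne) (key y x hxy.symm (hxy ▸ hx1) (Ne.symm hne))

end PlaneSetup

/-- The weighted average `∫₀¹ t F(t r) dt`, which equals `r⁻² ∫₀ʳ σ F(σ) dσ` for `r ≠ 0`. -/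
def radAvg (F : ℝ → ℝ) (r : ℝ) : ℝ := ∫ t in (0:ℝ)..1, t * F (t * r)

/-- The radial solution of `u'' + u'/r = -F` with `u(0) = α`, `u'(0) = 0`. -/
def radSol (F : ℝ → ℝ) (α r : ℝ) : ℝ := α - ∫ τ in (0:ℝ)..r, τ * radAvg F τ

lemma continuous_radAvg {F : ℝ → ℝ} (hF : Continuous F) : Continuous (radAvg F) := by
  unfold radAvg
  refine intervalIntegral.continuous_parametric_intervalIntegral_of_continuous' ?_ 0 1
  simp only [Function.uncurry_def]
  fun_prop

lemma hasDerivAt_radSol {F : ℝ → ℝ} (hF : Continuous F) (α r : ℝ) :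
    HasDerivAt (radSol F α) (-(r * radAvg F r)) r := by
  have h : Continuous fun τ => τ * radAvg F τ := continuous_id.mul (continuous_radAvg hF)
  exact (h.integral_hasStrictDerivAt 0 r).hasDerivAt.const_sub α

lemma continuous_radSol {F : ℝ → ℝ} (hF : Continuous F) (α : ℝ) : Continuous (radSol F α) :=
  continuous_iff_continuousAt.2 fun r => (hasDerivAt_radSol hF α r).continuousAt

@[simp] lemma radSol_zero (F : ℝ → ℝ) (α : ℝ) : radSol F α 0 = α := by simp [radSol]

lemma sq_mul_radAvg (F : ℝ → ℝ) (r : ℝ) : r ^ 2 * radAvg F r = ∫ σ in (0:ℝ)..r, σ * F σ := by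
  have h := intervalIntegral.smul_integral_comp_mul_left (a := 0) (b := 1) (fun σ => σ * F σ) r
  simp only [mul_zero, mul_one, smul_eq_mul] at h
  rw [← h, radAvg, sq, mul_assoc, ← intervalIntegral.integral_const_mul]
  congr 1
  refine intervalIntegral.integral_congr fun t _ => ?_
  simp only [mul_comm t r, mul_assoc]

lemma hasDerivAt_sq_mul_radAvg {F : ℝ → ℝ} (hF : Continuous F) (r : ℝ) :
    HasDerivAt (fun r => r ^ 2 * radAvg F r) (r * F r) r := by
  simp_rw [sq_mul_radAvg]
  exact ((continuous_id.mul hF).integral_hasStrictDerivAt 0 r).hasDerivAt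

lemma radAvg_congr {F G : ℝ → ℝ} {r : ℝ} (h : ∀ σ ∈ Icc 0 r, F σ = G σ) (hr : 0 ≤ r) :
    radAvg F r = radAvg G r := by
  refine intervalIntegral.integral_congr fun t ht => ?_
  rw [uIcc_of_le zero_le_one] at ht
  have : F (t * r) = G (t * r) := h _ ⟨mul_nonneg ht.1 hr, mul_le_of_le_one_left hr ht.2⟩
  simp only [this]

lemma radSol_congr {F G : ℝ → ℝ} {r α : ℝ} (h : ∀ σ ∈ Icc 0 r, F σ = G σ) (hr : 0 ≤ r) :
    radSol F α r = radSol G α r := by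
  unfold radSol
  congr 1
  refine intervalIntegral.integral_congr fun t ht => ?_
  rw [uIcc_of_le hr] at ht
  simp only [radAvg_congr (fun σ hσ => h σ ⟨hσ.1, hσ.2.trans ht.2⟩) ht.1]

lemma abs_radAvg_sub_le {F G : ℝ → ℝ} (hF : Continuous F) (hG : Continuous G) {r B : ℝ}
    (hr : 0 ≤ r) (h : ∀ σ ∈ Icc 0 r, |F σ - G σ| ≤ B) : |radAvg F r - radAvg G r| ≤ B := by
  unfold radAvg
  rw [← intervalIntegral.integral_sub
    (Continuous.intervalIntegrable (by fun_prop) _ _)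
    (Continuous.intervalIntegrable (by fun_prop) _ _)]
  have := intervalIntegral.norm_integral_le_of_norm_le_const (a := 0) (b := 1) (C := B)
    (f := fun t => t * F (t * r) - t * G (t * r)) (fun t ht => by
      rw [uIoc_of_le zero_le_one] at ht
      rw [← mul_sub, Real.norm_eq_abs, abs_mul, abs_of_pos ht.1]
      have h1 := h (t * r) ⟨mul_nonneg ht.1.le hr, mul_le_of_le_one_left hr ht.2⟩
      have h2 := abs_nonneg (F (t * r) - G (t * r))
      nlinarith [ht.2, ht.1])
  simpa using this

section Volterra

variable (Φ : ℝ → ℝ → ℝ) (κ : ℝ)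

/-- The source term associated with the weighted unknown `y`. -/
def volterraSource (y : C(Icc (0:ℝ) 1, ℝ)) (σ : ℝ) : ℝ :=
  Φ σ (Real.exp (κ * σ) * IccExtend zero_le_one y σ)

variable {Φ}

lemma continuous_volterraSource (hΦ : Continuous fun z : ℝ × ℝ => Φ z.1 z.2)
    (y : C(Icc (0:ℝ) 1, ℝ)) : Continuous (volterraSource Φ κ y) := by
  have h1 : Continuous (IccExtend (zero_le_one (α := ℝ)) y) := y.continuous.Icc_extend'
  exact hΦ.comp (by fun_prop :
    Continuous fun σ => (σ, Real.exp (κ * σ) * IccExtend zero_le_one y σ))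

/-- The Volterra operator conjugated by an exponential weight. -/
def volterraMap (hΦ : Continuous fun z : ℝ × ℝ => Φ z.1 z.2) (α : ℝ) (y : C(Icc (0:ℝ) 1, ℝ)) :
    C(Icc (0:ℝ) 1, ℝ) where
  toFun r := Real.exp (-(κ * r)) * radSol (volterraSource Φ κ y) α r
  continuous_toFun := by
    have := continuous_radSol (continuous_volterraSource κ hΦ y) α
    fun_prop

lemma volterraMap_contracting (hΦ : Continuous fun z : ℝ × ℝ => Φ z.1 z.2) {L : ℝ} (hL : 0 < L)
    (hlip : ∀ r a b, |Φ r a - Φ r b| ≤ L * |a - b|) (α : ℝ) :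
    ContractingWith (1 / 2) (volterraMap (2 * L) hΦ α) := by
  refine ⟨by norm_num, LipschitzWith.of_dist_le_mul fun y z => ?_⟩
  rw [ContinuousMap.dist_le (by positivity)]
  rintro ⟨r, hr⟩
  have hcy := continuous_volterraSource (2 * L) hΦ y
  have hcz := continuous_volterraSource (2 * L) hΦ z
  set D := dist y z with hD
  have hD0 : 0 ≤ D := dist_nonneg
  have hpt : ∀ σ, |volterraSource Φ (2 * L) y σ - volterraSource Φ (2 * L) z σ|
      ≤ L * Real.exp (2 * L * σ) * D := by
    intro σ
    refine (hlip _ _ _).trans ?_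
    rw [← mul_sub, abs_mul, abs_of_pos (Real.exp_pos _)]
    have h1 : |IccExtend zero_le_one y σ - IccExtend zero_le_one z σ| ≤ D := by
      have := ContinuousMap.dist_apply_le_dist (f := y) (g := z) (projIcc 0 1 zero_le_one σ)
      rwa [Real.dist_eq] at this
    calc _ ≤ L * (Real.exp (2 * L * σ) * D) :=
          mul_le_mul_of_nonneg_left (mul_le_mul_of_nonneg_left h1 (Real.exp_pos _).le) hL.le
      _ = _ := by ring
  have hmain : |radSol (volterraSource Φ (2 * L) y) α r - radSol (volterraSource Φ (2 * L) z) α r|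
      ≤ (1 / 2 * Real.exp (2 * L * r)) * D := by
    unfold radSol
    have h1 : Continuous fun τ => τ * radAvg (volterraSource Φ (2 * L) y) τ :=
      continuous_id.mul (continuous_radAvg hcy)
    have h2 : Continuous fun τ => τ * radAvg (volterraSource Φ (2 * L) z) τ :=
      continuous_id.mul (continuous_radAvg hcz)
    rw [sub_sub_sub_cancel_left, ← intervalIntegral.integral_sub (h2.intervalIntegrable _ _)
      (h1.intervalIntegrable _ _)]
    have hb : ∀ τ ∈ Ioc 0 r, ‖τ * radAvg (volterraSource Φ (2 * L) z) τ
        - τ * radAvg (volterraSource Φ (2 * L) y) τ‖ ≤ L * Real.exp (2 * L * τ) * D := by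
      intro τ hτ
      rw [← mul_sub, Real.norm_eq_abs, abs_mul, abs_of_pos hτ.1, abs_sub_comm]
      have h3 := abs_radAvg_sub_le hcy hcz (B := L * Real.exp (2 * L * τ) * D) hτ.1.le
        (fun σ hσ => (hpt σ).trans (by have := hσ.2; gcongr))
      have h4 : τ ≤ 1 := hτ.2.trans hr.2
      have h5 := abs_nonneg (radAvg (volterraSource Φ (2 * L) y) τ
        - radAvg (volterraSource Φ (2 * L) z) τ)
      nlinarith [hτ.1]
    have h3 := intervalIntegral.norm_integral_le_of_norm_le (μ := volume)
      (g := fun τ => L * Real.exp (2 * L * τ) * D) hr.1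
      (ae_of_all _ hb) (Continuous.intervalIntegrable (by fun_prop) _ _)
    rw [Real.norm_eq_abs] at h3
    refine h3.trans ?_
    have h4 : ∫ τ in (0:ℝ)..r, L * Real.exp (2 * L * τ) * D
        = 1 / 2 * Real.exp (2 * L * r) * D - 1 / 2 * Real.exp (2 * L * 0) * D := by
      refine intervalIntegral.integral_eq_sub_of_hasDerivAt
        (f := fun τ => 1 / 2 * Real.exp (2 * L * τ) * D) (fun τ _ => ?_)
        (Continuous.intervalIntegrable (by fun_prop) _ _)
      have h := ((((hasDerivAt_id τ).const_mul (2 * L)).exp).const_mul (1 / 2)).mul_const D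
      exact h.congr_deriv (by dsimp only [id]; ring)
    rw [h4]
    simp only [mul_zero, Real.exp_zero]
    linarith
  have he : Real.exp (-(2 * L * r)) * Real.exp (2 * L * r) = 1 := by rw [← Real.exp_add]; simp
  rw [Real.dist_eq]
  simp only [volterraMap, ContinuousMap.coe_mk]
  rw [← mul_sub, abs_mul, abs_of_pos (Real.exp_pos _)]
  calc _ ≤ Real.exp (-(2 * L * r)) * ((1 / 2 * Real.exp (2 * L * r)) * D) := by gcongr
    _ = (Real.exp (-(2 * L * r)) * Real.exp (2 * L * r)) * (1 / 2 * D) := by ring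
    _ = _ := by rw [he]; simp

/-- Solvability of the radial initial value problem with continuous dependence. -/
theorem exists_radial_flow (hΦ : Continuous fun z : ℝ × ℝ => Φ z.1 z.2) {L : ℝ} (hL : 0 < L)
    (hlip : ∀ r a b, |Φ r a - Φ r b| ≤ L * |a - b|) :
    ∃ (U : ℝ → ℝ → ℝ) (C : ℝ), (∀ α, Continuous (U α)) ∧
      (∀ α, ∀ r ∈ Icc (0:ℝ) 1, U α r = radSol (fun σ => Φ σ (U α σ)) α r) ∧
      (∀ α β, |U α 1 - U β 1| ≤ C * |α - β|) ∧
      ∀ α φ, ContinuousOn φ (Icc 0 1) →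
        (∀ r ∈ Icc (0:ℝ) 1, φ r = radSol (fun σ => Φ σ (φ σ)) α r) →
        ∀ r ∈ Icc (0:ℝ) 1, φ r = U α r := by
  have hT := volterraMap_contracting hΦ hL hlip
  set T := volterraMap (2 * L) hΦ with hTdef
  let Y : ℝ → C(Icc (0:ℝ) 1, ℝ) := fun α => (hT α).fixedPoint
  have hY : ∀ α, T α (Y α) = Y α := fun α => (hT α).fixedPoint_isFixedPt
  have hee : ∀ r, Real.exp (2 * L * r) * Real.exp (-(2 * L * r)) = 1 := fun r => by
    rw [← Real.exp_add]; simp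
  have hYr : ∀ α, ∀ r : Icc (0:ℝ) 1, Real.exp (2 * L * r) * Y α r
      = radSol (volterraSource Φ (2 * L) (Y α)) α r := by
    intro α r
    have h1 : T α (Y α) r = Y α r := by rw [hY]
    rw [← h1]
    simp only [hTdef, volterraMap, ContinuousMap.coe_mk]
    rw [← mul_assoc, hee, one_mul]
  refine ⟨fun α σ => Real.exp (2 * L * σ) * IccExtend zero_le_one (Y α) σ,
    2 * Real.exp (2 * L), fun α => ?_, fun α r hr => ?_, fun α β => ?_, fun α φ hφ hsol r hr => ?_⟩
  · have h1 : Continuous (IccExtend (zero_le_one (α := ℝ)) (Y α)) := (Y α).continuous.Icc_extend'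
    fun_prop
  · have h1 := hYr α ⟨r, hr⟩
    rw [← IccExtend_of_mem zero_le_one (Y α) hr] at h1
    exact h1
  · have h1 : dist (Y α) (Y β) ≤ |α - β| / (1 - (1 / 2 : NNReal)) := by
      refine (hT α).dist_fixedPoint_fixedPoint_of_dist_le' (T β) (hY α) (hY β) fun z => ?_
      rw [ContinuousMap.dist_le (abs_nonneg _)]
      rintro ⟨r, hr⟩
      rw [Real.dist_eq]
      simp only [hTdef, volterraMap, ContinuousMap.coe_mk, radSol]
      rw [← mul_sub, sub_sub_sub_cancel_right, abs_mul, abs_of_pos (Real.exp_pos _)]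
      refine mul_le_of_le_one_left (abs_nonneg _) ?_
      rw [Real.exp_le_one_iff]
      have := mul_nonneg hL.le hr.1
      linarith
    have h2 := ContinuousMap.dist_apply_le_dist (f := Y α) (g := Y β) ⟨1, by simp⟩
    rw [Real.dist_eq] at h2
    have h1m : (1:ℝ) ∈ Icc (0:ℝ) 1 := by simp
    simp only [IccExtend_of_mem _ _ h1m, mul_one]
    rw [← mul_sub, abs_mul, abs_of_pos (Real.exp_pos _)]
    have h3 : |α - β| / (1 - (1 / 2 : NNReal)) = 2 * |α - β| := by
      push_cast; ring
    rw [h3] at h1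
    calc _ ≤ Real.exp (2 * L) * (2 * |α - β|) := by gcongr; exact h2.trans h1
      _ = _ := by ring
  · let z : C(Icc (0:ℝ) 1, ℝ) :=
      ⟨fun r => Real.exp (-(2 * L * r)) * φ r, by
        have h2 : Continuous fun r : Icc (0:ℝ) 1 => φ r := hφ.domRestrict
        exact (by fun_prop : Continuous fun r : Icc (0:ℝ) 1 =>
          Real.exp (-(2 * L * (r : ℝ)))).mul h2⟩
    have hz : T α z = z := by
      ext ⟨r, hr⟩
      simp only [hTdef, volterraMap, ContinuousMap.coe_mk, z]
      rw [hsol r hr]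
      congr 1
      refine radSol_congr (fun σ hσ => ?_) hr.1
      have hσ' : σ ∈ Icc (0:ℝ) 1 := ⟨hσ.1, hσ.2.trans hr.2⟩
      simp only [volterraSource, IccExtend_of_mem _ _ hσ', ContinuousMap.coe_mk]
      rw [← mul_assoc, hee, one_mul]
    have hzY : z = Y α := (hT α).fixedPoint_unique hz
    beta_reduce
    rw [← hzY, IccExtend_of_mem _ _ hr]
    simp only [z, ContinuousMap.coe_mk]
    rw [← mul_assoc, hee, one_mul]

end Volterra

lemma eq_left_of_hasDerivAt_zero {f : ℝ → ℝ} {a b : ℝ} (hc : ContinuousOn f (Icc a b))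
    (hd : ∀ x ∈ Ioo a b, HasDerivAt f 0 x) : ∀ x ∈ Icc a b, f x = f a := by
  intro x hx
  have ha : a ∈ Icc a b := ⟨le_rfl, hx.1.trans hx.2⟩
  have hm : MonotoneOn f (Icc a b) := by
    refine monotoneOn_of_deriv_nonneg (convex_Icc a b) hc ?_ ?_ <;> rw [interior_Icc]
    · exact fun y hy => (hd y hy).differentiableAt.differentiableWithinAt
    · exact fun y hy => (hd y hy).deriv.ge
  have hm' : AntitoneOn f (Icc a b) := by
    refine antitoneOn_of_deriv_nonpos (convex_Icc a b) hc ?_ ?_ <;> rw [interior_Icc]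
    · exact fun y hy => (hd y hy).differentiableAt.differentiableWithinAt
    · exact fun y hy => (hd y hy).deriv.le
  exact le_antisymm (hm' ha hx hx.1) (hm ha hx hx.1)

lemma rpow_sub_rpow_le {q t t' : ℝ} (hq : 1 ≤ q) (ht : 0 ≤ t) (htt' : t ≤ t') :
    t' ^ q - t ^ q ≤ q * t' ^ (q - 1) * (t' - t) := by
  rcases ht.eq_or_lt with rfl | ht0
  · rcases htt'.eq_or_lt with rfl | h'
    · simp
    · have : t' ^ q = t' ^ (q - 1) * t' := by
        rw [← Real.rpow_add_one h'.ne', sub_add_cancel]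
      rw [Real.zero_rpow (by linarith), this]
      have := mul_pos (Real.rpow_pos_of_pos h' (q - 1)) h'
      nlinarith
  have h' : 0 < t' := ht0.trans_le htt'
  have h1 := one_add_mul_self_le_rpow_one_add (s := t / t' - 1) (p := q)
    (by have := div_nonneg ht h'.le; linarith) hq
  rw [add_sub_cancel, Real.div_rpow ht h'.le, le_div_iff₀ (Real.rpow_pos_of_pos h' q)] at h1
  have h2 : t' ^ q = t' ^ (q - 1) * t' := by
    rw [← Real.rpow_add_one h'.ne', sub_add_cancel]
  have h3 : (1 + q * (t / t' - 1)) * t' ^ q = t' ^ q + q * t' ^ (q - 1) * (t - t') := by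
    rw [h2]; field_simp
  linarith

/-- The radial weight `(1 + |r|^k)^(-s)`. -/
def wt (k s r : ℝ) : ℝ := (1 + |r| ^ k) ^ (-s)

lemma one_le_one_add_abs_rpow (k r : ℝ) : 1 ≤ 1 + |r| ^ k := by
  have := Real.rpow_nonneg (abs_nonneg r) k; linarith

lemma wt_pos (k s r : ℝ) : 0 < wt k s r :=
  Real.rpow_pos_of_pos (by have := one_le_one_add_abs_rpow k r; linarith) _

lemma wt_le_one {s : ℝ} (hs : 0 ≤ s) (k r : ℝ) : wt k s r ≤ 1 :=
  Real.rpow_le_one_of_one_le_of_nonpos (one_le_one_add_abs_rpow k r) (by linarith)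

lemma continuous_wt {k : ℝ} (hk : 0 ≤ k) (s : ℝ) : Continuous (wt k s) := by
  refine Continuous.rpow_const ?_ fun r => Or.inl ?_
  · exact continuous_const.add (continuous_abs.rpow_const fun _ => Or.inr hk)
  · have := one_le_one_add_abs_rpow k r
    linarith

lemma wt_anti {k s : ℝ} (hk : 0 ≤ k) (hs : 0 ≤ s) {r r' : ℝ} (hr : 0 ≤ r) (h : r ≤ r') :
    wt k s r' ≤ wt k s r := by
  have h1 := one_le_one_add_abs_rpow k r
  refine Real.rpow_le_rpow_of_nonpos (by linarith) ?_ (by linarith)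
  rw [abs_of_nonneg hr, abs_of_nonneg (hr.trans h)]
  gcongr

/-- The autonomous-in-angle source `μ t + (1 + |r|^k)^(-s) t^q`. -/
def src (k s μ q r t : ℝ) : ℝ := μ * t + wt k s r * t ^ q

lemma continuous_src {k q : ℝ} (hk : 0 ≤ k) (s μ : ℝ) (hq : 0 ≤ q) {u : ℝ → ℝ}
    (hu : Continuous u) : Continuous fun r => src k s μ q r (u r) :=
  (continuous_const.mul hu).add
    ((continuous_wt hk s).mul (hu.rpow_const fun _ => Or.inr hq))

lemma src_pos {k s μ q r t : ℝ} (hμ : 0 < μ) (ht : 0 < t) : 0 < src k s μ q r t :=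
  add_pos (mul_pos hμ ht) (mul_pos (wt_pos k s r) (Real.rpow_pos_of_pos ht q))

/-- Radial profile of a positive solution on the unit disc. -/
structure RadialProfile (k s μ q α : ℝ) (u F : ℝ → ℝ) : Prop where
  cont : Continuous F
  eq : u = radSol F α
  source : ∀ r ∈ Icc (0:ℝ) 1, F r = src k s μ q r (u r)
  pos : ∀ r ∈ Ico (0:ℝ) 1, 0 < u r
  zero : u 1 = 0

/-- Radial retraction onto the closed unit disc. -/
def retr (x : Euc 2) : Euc 2 := (max 1 ‖x‖)⁻¹ • x

lemma retr_of_le {x : Euc 2} (hx : ‖x‖ ≤ 1) : retr x = x := by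
  simp [retr, max_eq_left hx]

lemma norm_retr_of_le {x : Euc 2} (hx : 1 ≤ ‖x‖) : ‖retr x‖ = 1 := by
  have : 0 < ‖x‖ := by linarith
  simp [retr, max_eq_right hx, norm_smul, this.ne']

lemma norm_retr_le (x : Euc 2) : ‖retr x‖ ≤ 1 := by
  rcases le_total ‖x‖ 1 with h | h
  · rwa [retr_of_le h]
  · exact (norm_retr_of_le h).le

lemma continuous_retr : Continuous retr := by
  refine ((continuous_const.max continuous_norm).inv₀ fun x => ?_).smul continuous_id
  have := le_max_left 1 ‖x‖
  linarith

lemma closure_unitBall : closure (Metric.ball (0 : Euc 2) 1) = Metric.closedBall 0 1 :=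
  closure_ball _ one_ne_zero

lemma frontier_unitBall : frontier (Metric.ball (0 : Euc 2) 1) = Metric.sphere 0 1 :=
  frontier_ball _ one_ne_zero

section

variable {k s p lam : ℝ} {v : Euc 2 → ℝ}

lemma planeSetup_of_isPosSolution (hs : 0 ≤ s) (hk : 0 ≤ k) (hp : 2 < p) (hlam : lam < 0)
    (hv : IsPosSolution (Metric.ball (0 : Euc 2) 1) (fker 2 k s p) lam v) :
    PlaneSetup (src k s (-lam) (p - 1)) (v ∘ retr) := by
  obtain ⟨h1, h2, h3, h4, h5⟩ := hv
  rw [closure_unitBall] at h2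
  rw [frontier_unitBall] at h4
  have hloc : ∀ x : Euc 2, ‖x‖ < 1 → v ∘ retr =ᶠ[𝓝 x] v := fun x hx => by
    filter_upwards [Metric.isOpen_ball.mem_nhds (mem_ball_zero_iff.2 hx)] with y hy
    simp only [Function.comp, retr_of_le (mem_ball_zero_iff.1 hy).le]
  have hv2 : ∀ x : Euc 2, ‖x‖ < 1 → ContDiffAt ℝ 2 v x := fun x hx =>
    h1.contDiffAt (Metric.isOpen_ball.mem_nhds (mem_ball_zero_iff.2 hx))
  refine ⟨?_, ?_, ?_, ?_, ?_, ?_, ?_, ?_⟩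
  · intro r r' t hr hrr' _ ht
    have := wt_anti hk hs hr hrr'
    have := Real.rpow_nonneg ht.le (p - 1)
    unfold src; gcongr
  · intro r t t' _ _ ht htt'
    have := (wt_pos k s r).le
    have := Real.rpow_le_rpow ht.le htt' (by linarith : 0 ≤ p - 1)
    unfold src
    have : -lam * t ≤ -lam * t' := by nlinarith
    gcongr
  · intro M
    refine ⟨-lam + (p - 1) * M ^ (p - 1 - 1), fun r t t' _ _ ht htt' htM => ?_⟩
    have e1 := rpow_sub_rpow_le (q := p - 1) (by linarith) ht.le htt'
    have e2 : t' ^ (p - 1 - 1) ≤ M ^ (p - 1 - 1) :=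
      Real.rpow_le_rpow (by linarith) htM (by linarith)
    have e3 : t' ^ (p - 1) - t ^ (p - 1) ≤ (p - 1) * M ^ (p - 1 - 1) * (t' - t) := by
      refine e1.trans ?_
      have : 0 ≤ t' - t := by linarith
      have : 0 ≤ p - 1 := by linarith
      gcongr
    have e4 := wt_le_one hs k r
    have e5 := wt_pos k s r
    have e6 : 0 ≤ t' ^ (p - 1) - t ^ (p - 1) :=
      sub_nonneg.2 (Real.rpow_le_rpow ht.le htt' (by linarith))
    unfold src
    nlinarith
  · exact h2.comp_continuous continuous_retr fun x => by simpa using norm_retr_le x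
  · exact fun x hx => (hv2 x hx).congr_of_eventuallyEq (hloc x hx)
  · intro x hx
    simp only [Function.comp, retr_of_le hx.le]
    exact h3 x (mem_ball_zero_iff.2 hx)
  · intro x hx
    exact h4 _ (by simpa using norm_retr_of_le hx)
  · intro x hx
    have := h5 x (mem_ball_zero_iff.2 hx)
    rw [lap_congr (hloc x hx)]
    simp only [Function.comp, retr_of_le hx.le]
    simp only [fker] at this
    simp only [src, wt, abs_norm]
    linarith

/-- The first coordinate vector of the plane. -/
abbrev e₀ : Euc 2 := EuclideanSpace.single 0 1

lemma lap_radial {f : ℝ → ℝ → ℝ} {u : Euc 2 → ℝ} (h : PlaneSetup f u) {r : ℝ} (hr0 : 0 < r)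
    (hr1 : r < 1) (hρ : ContDiffOn ℝ 2 (fun t : ℝ => u (t • e₀)) (Ioo (-1) 1)) :
    lap u (r • e₀) = deriv (deriv fun t : ℝ => u (t • e₀)) r
      + deriv (fun t : ℝ => u (t • e₀)) r / r := by
  set ρ := fun t : ℝ => u (t • e₀) with hρdef
  have hn : ‖r • e₀‖ < 1 := by rw [norm_smul]; simpa [abs_of_pos hr0] using hr1
  have hd : ∀ t ∈ Ioo (-1:ℝ) 1, DifferentiableAt ℝ ρ t := fun t ht =>
    (hρ.contDiffAt (isOpen_Ioo.mem_nhds ht)).differentiableAt (by norm_num)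
  have hd2 : DifferentiableAt ℝ (deriv ρ) r := by
    have := hρ.deriv_of_isOpen (m := 1) isOpen_Ioo (by norm_num)
    exact (this.contDiffAt (isOpen_Ioo.mem_nhds ⟨by linarith, hr1⟩)).differentiableAt (by norm_num)
  rw [lap_eq_sum_single (h.smooth _ hn), Fin.sum_univ_two]
  congr 1
  · have : (fun t : ℝ => u (r • e₀ + t • EuclideanSpace.single 0 1)) = fun t => ρ (r + t) := by
      ext t; simp only [hρdef, add_smul]
    rw [this]
    have e1 : deriv (fun t => ρ (r + t)) = fun t => deriv ρ (r + t) := by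
      ext t; exact deriv_comp_const_add ρ r t
    rw [e1, deriv_comp_const_add, add_zero]
  · have hq : ∀ t : ℝ, 0 < r ^ 2 + t ^ 2 := fun t => by positivity
    have hev : ∀ᶠ t : ℝ in 𝓝 0, r ^ 2 + t ^ 2 < 1 := by
      have : Tendsto (fun t : ℝ => r ^ 2 + t ^ 2) (𝓝 0) (𝓝 (r ^ 2 + 0 ^ 2)) :=
        Continuous.tendsto (by fun_prop) 0
      refine this.eventually (gt_mem_nhds ?_)
      nlinarith
    have hnorm : ∀ t : ℝ, ‖r • e₀ + t • (EuclideanSpace.single 1 1 : Euc 2)‖ = √(r ^ 2 + t ^ 2) := by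
      intro t
      rw [EuclideanSpace.norm_eq]
      simp [Fin.sum_univ_two]
    have hrad : (fun t : ℝ => u (r • e₀ + t • EuclideanSpace.single 1 1))
        =ᶠ[𝓝 0] fun t => ρ √(r ^ 2 + t ^ 2) := by
      filter_upwards [hev] with t ht
      have h1 : √(r ^ 2 + t ^ 2) ≤ 1 := Real.sqrt_le_one.2 ht.le
      refine h.radial ?_ ?_
      · rw [hnorm, norm_smul]; simp [abs_of_nonneg (Real.sqrt_nonneg _)]
      · rw [hnorm]; exact h1
    have hrad' : deriv (fun t : ℝ => u (r • e₀ + t • EuclideanSpace.single 1 1))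
        =ᶠ[𝓝 0] fun t => deriv ρ √(r ^ 2 + t ^ 2) / √(r ^ 2 + t ^ 2) * t := by
      refine hrad.deriv.trans ?_
      filter_upwards [hev] with t ht
      have h1 : √(r ^ 2 + t ^ 2) < 1 := by rwa [Real.sqrt_lt' one_pos, one_pow]
      have h2 : HasDerivAt (fun t : ℝ => √(r ^ 2 + t ^ 2)) (t / √(r ^ 2 + t ^ 2)) t := by
        have := ((hasDerivAt_pow 2 t).const_add (r ^ 2)).sqrt (hq t).ne'
        refine this.congr_deriv ?_
        have := (Real.sqrt_pos.2 (hq t)).ne'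
        field_simp
        simp
      have h3 := (hd _ ⟨by linarith [Real.sqrt_nonneg (r ^ 2 + t ^ 2)], h1⟩).hasDerivAt.comp t h2
      rw [show (fun t : ℝ => ρ √(r ^ 2 + t ^ 2)) = ρ ∘ fun t : ℝ => √(r ^ 2 + t ^ 2) from rfl,
        h3.deriv]
      ring
    rw [hrad'.deriv_eq]
    have hs0 : √(r ^ 2 + (0:ℝ) ^ 2) = r := by
      rw [zero_pow two_ne_zero, add_zero, Real.sqrt_sq hr0.le]
    have hg : DifferentiableAt ℝ (fun t : ℝ => deriv ρ √(r ^ 2 + t ^ 2) / √(r ^ 2 + t ^ 2)) 0 := by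
      have hsq : DifferentiableAt ℝ (fun t : ℝ => √(r ^ 2 + t ^ 2)) 0 :=
        DifferentiableAt.sqrt (by fun_prop) (hq 0).ne'
      refine DifferentiableAt.div ?_ hsq (by rw [hs0]; exact hr0.ne')
      exact DifferentiableAt.comp (0:ℝ) (by rw [hs0]; exact hd2) hsq
    have := hg.hasDerivAt.mul (hasDerivAt_id (0:ℝ))
    refine (this.deriv.trans ?_ : _)
    simp [hr0.le]


theorem exists_profile_of_isPosSolution (hs : 0 ≤ s) (hk : 0 ≤ k) (hp : 2 < p) (hlam : lam < 0)
    (hv : IsPosSolution (Metric.ball (0 : Euc 2) 1) (fker 2 k s p) lam v) :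
    ∃ α u F, RadialProfile k s (-lam) (p - 1) α u F ∧ ∀ x : Euc 2, ‖x‖ ≤ 1 → v x = u ‖x‖ := by
  have h := planeSetup_of_isPosSolution hs hk hp hlam hv
  set w := v ∘ retr with hw
  set ρ := fun t : ℝ => w (t • e₀) with hρdef
  have hnorm : ∀ t : ℝ, ‖t • e₀‖ = |t| := fun t => by rw [norm_smul]; simp
  have hρc : Continuous ρ := h.cont.comp (continuous_id.smul continuous_const)
  have hρ2 : ContDiffOn ℝ 2 ρ (Ioo (-1) 1) := by
    intro t ht
    refine ContDiffAt.contDiffWithinAt ?_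
    have h1 := h.smooth (t • e₀) (by rw [hnorm]; exact abs_lt.2 ht)
    exact h1.comp t (f := fun t : ℝ => t • e₀) (by fun_prop)
  set F := fun r => src k s (-lam) (p - 1) r (ρ r) with hF
  have hFc : Continuous F := continuous_src hk s _ (by linarith) hρc
  have hρ' : ContDiffOn ℝ 1 (deriv ρ) (Ioo (-1) 1) :=
    hρ2.deriv_of_isOpen (m := 1) isOpen_Ioo (by norm_num)
  have hd : ∀ t ∈ Ioo (-1:ℝ) 1, HasDerivAt ρ (deriv ρ t) t := fun t ht =>
    ((hρ2.contDiffAt (isOpen_Ioo.mem_nhds ht)).differentiableAt (by norm_num)).hasDerivAt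
  have hd2 : ∀ t ∈ Ioo (-1:ℝ) 1, HasDerivAt (deriv ρ) (deriv (deriv ρ) t) t := fun t ht =>
    ((hρ'.contDiffAt (isOpen_Ioo.mem_nhds ht)).differentiableAt (by norm_num)).hasDerivAt
  have hflux : ∀ r ∈ Ioo (0:ℝ) 1, r * deriv ρ r + r ^ 2 * radAvg F r = 0 := by
    intro b hb
    have hsub : Icc 0 b ⊆ Ioo (-1:ℝ) 1 := fun t ht => ⟨by linarith [ht.1], by linarith [ht.2, hb.2]⟩
    have := eq_left_of_hasDerivAt_zero (a := 0) (b := b)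
      (f := fun r => r * deriv ρ r + r ^ 2 * radAvg F r) ?_ ?_ b ⟨hb.1.le, le_rfl⟩
    · simpa using this
    · refine ContinuousOn.add (continuousOn_id.mul (hρ'.continuousOn.mono hsub)) ?_
      exact ((continuous_pow 2).mul (continuous_radAvg hFc)).continuousOn
    · intro r hr
      have hr' : r ∈ Ioo (-1:ℝ) 1 := hsub (Ioo_subset_Icc_self hr)
      have e1 := ((hasDerivAt_id r).mul (hd2 r hr')).add (hasDerivAt_sq_mul_radAvg hFc r)
      refine e1.congr_deriv ?_
      have e2 := lap_radial h hr.1 hr'.2 hρ2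
      rw [h.eq _ (by rw [hnorm]; exact abs_lt.2 hr'), hnorm, abs_of_pos hr.1] at e2
      have e3 : -F r = deriv (deriv ρ) r + deriv ρ r / r := e2
      have hr0 := hr.1.ne'
      have e4 : r * F r = -(r * deriv (deriv ρ) r + deriv ρ r) := by
        have : F r = -(deriv (deriv ρ) r + deriv ρ r / r) := by linarith
        rw [this]; field_simp
      rw [e4]
      simp
      ring
  have hsol : ∀ r ∈ Icc (0:ℝ) 1, ρ r = radSol F (ρ 0) r := by
    intro r hr
    have := eq_left_of_hasDerivAt_zero (a := 0) (b := 1)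
      (f := fun r => ρ r - radSol F (ρ 0) r)
      (hρc.sub (continuous_radSol hFc _)).continuousOn ?_ r hr
    · simp only [radSol_zero, sub_self] at this
      linarith
    · intro r hr
      refine ((hd r ⟨by linarith [hr.1], hr.2⟩).sub (hasDerivAt_radSol hFc _ r)).congr_deriv ?_
      have := hflux r hr
      have : r * (deriv ρ r + r * radAvg F r) = 0 := by linarith
      rcases mul_eq_zero.1 this with h0 | h0
      · exact absurd h0 hr.1.ne'
      · linarith
  have hwρ : ∀ x : Euc 2, ‖x‖ ≤ 1 → v x = ρ ‖x‖ := by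
    intro x hx
    have e1 : w x = ρ ‖x‖ := h.radial (by rw [hnorm, abs_norm]) hx
    rw [← e1]
    simp only [hw, Function.comp, retr_of_le hx]
  refine ⟨ρ 0, radSol F (ρ 0), F, ⟨hFc, rfl, fun r hr => ?_, fun r hr => ?_, ?_⟩, fun x hx => ?_⟩
  · rw [← hsol r hr]
  · rw [← hsol r ⟨hr.1, hr.2.le⟩]
    exact h.pos _ (by rw [hnorm, abs_of_nonneg hr.1]; exact hr.2)
  · rw [← hsol 1 (by simp)]
    exact h.zero _ (by rw [hnorm]; simp)
  · rw [hwρ x hx, hsol _ ⟨norm_nonneg x, hx⟩]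

end

section

open scoped Convolution

section Mollification

variable {E' : Type*} [NormedAddCommGroup E'] [NormedSpace ℝ E']

lemma normed_convolution_eq_zero {g : Euc 2 → E'} {R δ : ℝ} (hg : ∀ x, R ≤ ‖x‖ → g x = 0)
    (φ : ContDiffBump (0 : Euc 2)) (hφ : φ.rOut ≤ δ) {x : Euc 2} (hx : R + δ ≤ ‖x‖) :
    (φ.normed volume ⋆[ContinuousLinearMap.lsmul ℝ ℝ, volume] g) x = 0 := by
  by_contra h
  have := support_convolution_subset (ContinuousLinearMap.lsmul ℝ ℝ) (Function.mem_support.2 h)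
  obtain ⟨a, ha, b, hb, rfl⟩ := Set.mem_add.1 this
  rw [φ.support_normed_eq, mem_ball_zero_iff] at ha
  have hb' : ‖b‖ < R := lt_of_not_ge fun h' => hb (hg b h')
  have := norm_add_le a b
  linarith

lemma tendsto_integral_normed_convolution [CompleteSpace E'] {g : Euc 2 → E'} {R δ : ℝ} (hgc : Continuous g)
    (hg : ∀ x, R ≤ ‖x‖ → g x = 0) (φ : ℕ → ContDiffBump (0 : Euc 2))
    (hφ : ∀ n, (φ n).rOut ≤ δ) (hφ0 : Tendsto (fun n => (φ n).rOut) atTop (𝓝 0))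
    (hm : ∀ n, Continuous ((φ n).normed volume ⋆[ContinuousLinearMap.lsmul ℝ ℝ, volume] g)) :
    Tendsto (fun n => ∫ x, ‖((φ n).normed volume
      ⋆[ContinuousLinearMap.lsmul ℝ ℝ, volume] g) x‖ ^ 2) atTop (𝓝 (∫ x, ‖g x‖ ^ 2)) := by
  have hcs : HasCompactSupport g :=
    HasCompactSupport.intro (isCompact_closedBall (0 : Euc 2) R) fun x hx => by
      refine hg x ?_
      rw [mem_closedBall_zero_iff, not_le] at hx
      exact hx.le
  obtain ⟨C, hC⟩ := hcs.exists_bound_of_continuous hgc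
  have hb : ∀ n x, ‖((φ n).normed volume
      ⋆[ContinuousLinearMap.lsmul ℝ ℝ, volume] g) x‖ ≤ 3 * C := by
    intro n x
    have h1 := (φ n).dist_normed_convolution_le (μ := volume) (x₀ := x) (ε := 2 * C)
      hgc.aestronglyMeasurable fun y _ => by
        rw [dist_eq_norm]
        linarith [norm_sub_le (g y) (g x), hC x, hC y]
    rw [dist_eq_norm] at h1
    have h2 := norm_le_norm_add_norm_sub' (((φ n).normed volume
      ⋆[ContinuousLinearMap.lsmul ℝ ℝ, volume] g) x) (g x)
    linarith [hC x]
  refine tendsto_integral_of_dominated_convergence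
    ((Metric.closedBall (0 : Euc 2) (R + δ)).indicator fun _ => (3 * C) ^ 2)
    (fun n => ((hm n).norm.pow 2).aestronglyMeasurable) ?_ (fun n => ae_of_all _ fun x => ?_)
    (ae_of_all _ fun x => ?_)
  · refine IntegrableOn.integrable_indicator ?_ measurableSet_closedBall
    exact continuousOn_const.integrableOn_compact (isCompact_closedBall _ _)
  · by_cases hx : x ∈ Metric.closedBall (0 : Euc 2) (R + δ)
    · rw [indicator_of_mem hx, Real.norm_of_nonneg (by positivity)]
      exact pow_le_pow_left₀ (norm_nonneg _) (hb n x) 2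
    · rw [indicator_of_notMem hx, normed_convolution_eq_zero hg _ (hφ n)]
      · simp
      · rw [mem_closedBall_zero_iff, not_le] at hx
        exact hx.le
  · exact ((ContDiffBump.convolution_tendsto_right_of_continuous hφ0 hgc x).norm).pow 2

end Mollification

lemma bddBelow_rayleigh (Ω : Set (Euc 2)) :
    BddBelow { r : ℝ | ∃ φ : Euc 2 → ℝ, ContDiff ℝ (⊤ : ℕ∞) φ ∧ HasCompactSupport φ ∧
      tsupport φ ⊆ Ω ∧ φ ≠ 0 ∧
      r = (∫ x, ‖fderiv ℝ φ x‖ ^ 2) / (∫ x, (φ x) ^ 2) } := by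
  refine ⟨0, ?_⟩
  rintro r ⟨φ, -, -, -, -, rfl⟩
  positivity

/-- The Rayleigh inequality for continuously differentiable compactly supported functions. -/
theorem firstEig_mul_le_of_contDiff {V : Euc 2 → ℝ} {R : ℝ} (hR : R < 1)
    (hV : ContDiff ℝ 1 V) (hV0 : ∀ x, R ≤ ‖x‖ → V x = 0) :
    firstEig (Metric.ball (0 : Euc 2) 1) * ∫ x, V x ^ 2 ≤ ∫ x, ‖fderiv ℝ V x‖ ^ 2 := by
  set δ := (1 - R) / 3 with hδ
  have hδ0 : 0 < δ := by rw [hδ]; linarith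
  let φ : ℕ → ContDiffBump (0 : Euc 2) := fun n =>
    ⟨δ / (n + 1) / 2, δ / (n + 1), by positivity, half_lt_self (by positivity)⟩
  have hφδ : ∀ n, (φ n).rOut ≤ δ := fun n =>
    div_le_self hδ0.le (by have : (0:ℝ) ≤ n := Nat.cast_nonneg n; linarith)
  have hφ0 : Tendsto (fun n => (φ n).rOut) atTop (𝓝 0) := by
    have := (tendsto_one_div_add_atTop_nhds_zero_nat (𝕜 := ℝ)).const_mul δ
    simpa [φ, div_eq_mul_inv] using this
  have hcs : HasCompactSupport V :=
    HasCompactSupport.intro (isCompact_closedBall (0 : Euc 2) R) fun x hx => by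
      refine hV0 x ?_
      rw [mem_closedBall_zero_iff, not_le] at hx
      exact hx.le
  have hdV : Continuous (fderiv ℝ V) := hV.continuous_fderiv one_ne_zero
  have hli : ∀ n, LocallyIntegrable ((φ n).normed (volume : Measure (Euc 2))) volume := fun n =>
    (φ n).continuous_normed.locallyIntegrable
  let W : ℕ → Euc 2 → ℝ := fun n =>
    (φ n).normed volume ⋆[ContinuousLinearMap.lsmul ℝ ℝ, volume] V
  have hW : ∀ n, ContDiff ℝ (⊤ : ℕ∞) (W n) := fun n =>
    (φ n).hasCompactSupport_normed.contDiff_convolution_left _ (φ n).contDiff_normed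
      hV.continuous.locallyIntegrable
  have hdW : ∀ n, fderiv ℝ (W n) = (φ n).normed volume
      ⋆[ContinuousLinearMap.lsmul ℝ ℝ, volume] (fderiv ℝ V) := by
    intro n
    ext1 x
    rw [(hcs.hasFDerivAt_convolution_right (ContinuousLinearMap.lsmul ℝ ℝ) (hli n) hV x).fderiv]
    rfl
  have hdV0 : ∀ x, (R + δ) ≤ ‖x‖ → fderiv ℝ V x = 0 := by
    intro x hx
    have : V =ᶠ[𝓝 x] fun _ => 0 := by
      filter_upwards [continuous_norm.continuousAt.eventually (lt_mem_nhds
        (show R < ‖x‖ by linarith))] with y hy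
      exact hV0 y hy.le
    rw [this.fderiv_eq]
    simp
  have hcdV : HasCompactSupport (fderiv ℝ V) := hcs.fderiv ℝ
  have hineq : ∀ n, firstEig (Metric.ball (0 : Euc 2) 1) * ∫ x, ‖W n x‖ ^ 2
      ≤ ∫ x, ‖fderiv ℝ (W n) x‖ ^ 2 := by
    intro n
    simp only [Real.norm_eq_abs, sq_abs]
    rcases (integral_nonneg fun x => sq_nonneg (W n x) :
      0 ≤ ∫ x, W n x ^ 2).eq_or_lt with h0 | h0
    · rw [← h0, mul_zero]; positivity
    · rw [← le_div_iff₀ h0]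
      have hsub : tsupport (W n) ⊆ Metric.closedBall 0 (R + δ) := by
        refine closure_minimal (fun x hx => ?_) Metric.isClosed_closedBall
        by_contra hx'
        rw [mem_closedBall_zero_iff, not_le] at hx'
        exact hx (normed_convolution_eq_zero hV0 _ (hφδ n) hx'.le)
      refine csInf_le (bddBelow_rayleigh _) ⟨W n, hW n, ?_, ?_, ?_, rfl⟩
      · exact HasCompactSupport.of_support_subset_isCompact (isCompact_closedBall _ _)
          (subset_closure.trans hsub)
      · exact hsub.trans (Metric.closedBall_subset_ball (by rw [hδ]; linarith))
      · intro h
        simp [h] at h0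
  have t1 := tendsto_integral_normed_convolution hV.continuous hV0 φ hφδ hφ0
    fun n => (hW n).continuous
  have t2 := tendsto_integral_normed_convolution hdV hdV0 φ hφδ hφ0 fun n => by
    rw [← hdW]; exact (hW n).continuous_fderiv (by simp)
  simp_rw [← hdW] at t2
  have := le_of_tendsto_of_tendsto' (t1.const_mul _) t2 hineq
  simpa [Real.norm_eq_abs, sq_abs] using this

end

section RadialPDE

variable {F : ℝ → ℝ}

lemma radSol_eq_comp_sq (hF : Continuous F) (α : ℝ) {r : ℝ} (hr : 0 ≤ r) :
    radSol F α r = α - (∫ t in (0:ℝ)..r ^ 2, radAvg F √t) / 2 := by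
  have hc : Continuous fun t => radAvg F √t := (continuous_radAvg hF).comp Real.continuous_sqrt
  have hd : ∀ s, HasDerivAt (fun s => ∫ t in (0:ℝ)..s, radAvg F √t) (radAvg F √s) s :=
    fun s => (hc.integral_hasStrictDerivAt 0 s).hasDerivAt
  have hd' : ∀ x, HasDerivAt (fun s => ∫ t in (0:ℝ)..s ^ 2, radAvg F √t)
      (radAvg F √(x ^ 2) * (2 * x)) x := fun x => by
    have := (hd (x ^ 2)).comp x (hasDerivAt_pow 2 x)
    exact this.congr_deriv (by simp)
  have := eq_left_of_hasDerivAt_zero (a := 0) (b := r)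
    (f := fun x => radSol F α x - (α - (∫ t in (0:ℝ)..x ^ 2, radAvg F √t) / 2)) ?_ ?_ r ⟨hr, le_rfl⟩
  · simp at this
    linarith
  · exact fun x _ => ((hasDerivAt_radSol hF α x).sub
      (((hd' x).div_const 2).const_sub α)).continuousAt.continuousWithinAt
  · intro x hx
    refine ((hasDerivAt_radSol hF α x).sub (((hd' x).div_const 2).const_sub α)).congr_deriv ?_
    rw [Real.sqrt_sq hx.1.le]
    ring

lemma hasFDerivAt_radSol_norm (hF : Continuous F) (α : ℝ) (x : Euc 2) :
    HasFDerivAt (fun x : Euc 2 => radSol F α ‖x‖) (-(innerSL ℝ (radAvg F ‖x‖ • x))) x := by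
  have hc : Continuous fun t => radAvg F √t := (continuous_radAvg hF).comp Real.continuous_sqrt
  have hd := (hc.integral_hasStrictDerivAt 0 (‖x‖ ^ 2)).hasDerivAt
  have h1 : HasFDerivAt (fun x : Euc 2 => ‖x‖ ^ 2) (2 • innerSL ℝ x) x :=
    (hasStrictFDerivAt_norm_sq x).hasFDerivAt
  have h2 := ((hd.comp_hasFDerivAt x h1).const_mul (1 / 2)).const_sub α
  simp_rw [radSol_eq_comp_sq hF α (norm_nonneg _)]
  have h3 := h2.congr_fderiv (g' := -(innerSL ℝ (radAvg F ‖x‖ • x))) (by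
    rw [Real.sqrt_sq (norm_nonneg x)]
    ext y
    simp
    ring)
  refine h3.congr_of_eventuallyEq (Eventually.of_forall fun y => ?_)
  simp only [Function.comp]
  ring

lemma hasDerivAt_radAvg (hF : Continuous F) {r : ℝ} (hr : 0 < r) :
    HasDerivAt (radAvg F) ((F r - 2 * radAvg F r) / r) r := by
  have h1 := (hasDerivAt_sq_mul_radAvg hF r).div (hasDerivAt_pow 2 r) (pow_ne_zero 2 hr.ne')
  have h2 := h1.congr_of_eventuallyEq (f₁ := radAvg F) (by
    filter_upwards [lt_mem_nhds hr] with y hy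
    have := hy.ne'
    simp only [Pi.div_apply]
    field_simp)
  refine h2.congr_deriv ?_
  have := hr.ne'
  field_simp
  simp
  ring

lemma radAvg_zero (F : ℝ → ℝ) : radAvg F 0 = F 0 / 2 := by
  simp [radAvg]
  ring

/-- Derivative of the planar vector field `radAvg F ‖x‖ • x`. -/
def radField' (F : ℝ → ℝ) (x : Euc 2) : Euc 2 →L[ℝ] Euc 2 :=
  radAvg F ‖x‖ • ContinuousLinearMap.id ℝ (Euc 2) +
    ((F ‖x‖ - 2 * radAvg F ‖x‖) / ‖x‖ ^ 2) • (innerSL ℝ x).smulRight x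

lemma hasFDerivAt_radField (hF : Continuous F) (x : Euc 2) :
    HasFDerivAt (fun x : Euc 2 => radAvg F ‖x‖ • x) (radField' F x) x := by
  by_cases hx : x = 0
  · subst hx
    have : radField' F 0 = radAvg F 0 • ContinuousLinearMap.id ℝ (Euc 2) := by
      simp [radField']
    rw [this, hasFDerivAt_iff_isLittleO_nhds_zero]
    simp only [zero_add, norm_zero, smul_zero, sub_zero, smul_apply,
      ContinuousLinearMap.id_apply, ← sub_smul]
    have h1 : (fun h : Euc 2 => radAvg F ‖h‖ - radAvg F 0) =o[𝓝 0] fun _ => (1:ℝ) := by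
      rw [Asymptotics.isLittleO_one_iff]
      have : Continuous fun h : Euc 2 => radAvg F ‖h‖ - radAvg F 0 :=
        ((continuous_radAvg hF).comp continuous_norm).sub continuous_const
      have h := this.tendsto 0
      simpa using h
    simpa using h1.smul_isBigO (Asymptotics.isBigO_refl (fun h : Euc 2 => h) (𝓝 0))
  · have hr : 0 < ‖x‖ := norm_pos_iff.2 hx
    have h0 : HasFDerivAt (fun x : Euc 2 => ‖x‖) (‖x‖⁻¹ • innerSL ℝ x) x := by
      have h1 : HasFDerivAt (fun x : Euc 2 => ‖x‖ ^ 2) (2 • innerSL ℝ x) x :=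
        (hasStrictFDerivAt_norm_sq x).hasFDerivAt
      have h2 := h1.sqrt (pow_pos hr 2).ne'
      simp_rw [Real.sqrt_sq (norm_nonneg _)] at h2
      refine h2.congr_fderiv ?_
      ext y
      simp
      ring
    have h1 := ((hasDerivAt_radAvg hF hr).comp_hasFDerivAt x h0).smul (hasFDerivAt_id x)
    refine h1.congr_fderiv ?_
    ext1 y
    simp only [radField', add_apply, smul_apply,
      ContinuousLinearMap.smulRight_apply, Function.comp, id, smul_smul, ContinuousLinearMap.id_apply]
    congr 2
    simp only [smul_eq_mul]
    field_simp

lemma continuous_radField' (hF : Continuous F) : Continuous (radField' F) := by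
  have hg : Continuous fun x : Euc 2 => radAvg F ‖x‖ := (continuous_radAvg hF).comp continuous_norm
  have hFn : Continuous fun x : Euc 2 => F ‖x‖ := hF.comp continuous_norm
  refine (hg.smul continuous_const).add ?_
  have hs : Continuous fun x : Euc 2 => (innerSL ℝ x).smulRight x := by
    have : Continuous fun z : Euc 2 × Euc 2 => (innerSL ℝ z.1).smulRight z.2 :=
      (((ContinuousLinearMap.smulRightL ℝ (Euc 2) (Euc 2)).isBoundedBilinearMap).continuous).comp
        (((innerSL ℝ (E := Euc 2)).continuous.comp continuous_fst).prodMk continuous_snd)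
    exact this.comp (continuous_id.prodMk continuous_id)
  rw [continuous_iff_continuousAt]
  intro x
  by_cases hx : x = 0
  · subst hx
    rw [ContinuousAt]
    simp only [map_zero, norm_zero]
    have e0 : ((F 0 - 2 * radAvg F 0) / (0:ℝ) ^ 2) •
      ContinuousLinearMap.smulRight (0 : Euc 2 →L[ℝ] ℝ) (0 : Euc 2) = 0 := by
      ext1 y; simp
    rw [e0]
    have ht : Tendsto (fun x : Euc 2 => |F ‖x‖ - 2 * radAvg F ‖x‖|) (𝓝 0) (𝓝 0) := by
      have : Continuous fun x : Euc 2 => |F ‖x‖ - 2 * radAvg F ‖x‖| :=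
        (hFn.sub (continuous_const.mul hg)).abs
      have h := this.tendsto 0
      rw [norm_zero, radAvg_zero] at h
      have e : F 0 - 2 * (F 0 / 2) = 0 := by ring
      rwa [e, abs_zero] at h
    refine squeeze_zero_norm (fun x => ?_) ht
    rw [norm_smul, ContinuousLinearMap.norm_smulRight_apply, innerSL_apply_norm, norm_div,
      Real.norm_eq_abs, Real.norm_of_nonneg (sq_nonneg _), ← sq]
    rcases (norm_nonneg x).eq_or_lt with h | h
    · rw [← h]; simp
    · rw [div_mul_cancel₀ _ (pow_pos h 2).ne']
  · have hr : ‖x‖ ^ 2 ≠ 0 := pow_ne_zero 2 (norm_ne_zero_iff.2 hx)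
    exact ((hFn.sub (continuous_const.mul hg)).continuousAt.div
      (continuous_norm.pow 2).continuousAt hr).smul hs.continuousAt

lemma fderiv_radSol_norm (hF : Continuous F) (α : ℝ) :
    fderiv ℝ (fun x : Euc 2 => radSol F α ‖x‖) = fun x => -(innerSL ℝ (radAvg F ‖x‖ • x)) :=
  funext fun x => (hasFDerivAt_radSol_norm hF α x).fderiv

lemma contDiff_radSol_norm (hF : Continuous F) (α : ℝ) :
    ContDiff ℝ 2 (fun x : Euc 2 => radSol F α ‖x‖) := by
  have h1 : ContDiff ℝ 1 fun x : Euc 2 => radAvg F ‖x‖ • x := by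
    rw [contDiff_one_iff_fderiv]
    refine ⟨fun x => (hasFDerivAt_radField hF x).differentiableAt, ?_⟩
    have : fderiv ℝ (fun x : Euc 2 => radAvg F ‖x‖ • x) = radField' F :=
      funext fun x => (hasFDerivAt_radField hF x).fderiv
    rw [this]
    exact continuous_radField' hF
  have h2 : ContDiff ℝ (1 + 1) (fun x : Euc 2 => radSol F α ‖x‖) := by
    rw [contDiff_succ_iff_fderiv]
    refine ⟨fun x => (hasFDerivAt_radSol_norm hF α x).differentiableAt, by simp, ?_⟩
    rw [fderiv_radSol_norm hF]
    exact ((innerSL ℝ (E := Euc 2)).contDiff.comp h1).neg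
  exact h2

lemma lap_radSol_norm (hF : Continuous F) (α : ℝ) (x : Euc 2) :
    lap (fun x : Euc 2 => radSol F α ‖x‖) x = -F ‖x‖ := by
  have hi : ∀ e : Euc 2, fderiv ℝ (fun y => fderiv ℝ (fun x : Euc 2 => radSol F α ‖x‖) y e) x e
      = -(inner ℝ (radField' F x e) e) := by
    intro e
    rw [fderiv_radSol_norm hF]
    have h1 := ((innerSL ℝ e).hasFDerivAt.comp x (hasFDerivAt_radField hF x)).neg
    have h2 := h1.fderiv
    have h3 : (fun y : Euc 2 => (-(innerSL ℝ (radAvg F ‖y‖ • y))) e)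
        = -(innerSL ℝ e ∘ fun y => radAvg F ‖y‖ • y) := by
      ext y
      change -(inner ℝ (radAvg F ‖y‖ • y) e) = -(inner ℝ e (radAvg F ‖y‖ • y))
      rw [real_inner_comm]
    rw [h3, h2]
    change -(inner ℝ e (radField' F x e)) = _
    rw [real_inner_comm]
  unfold lap
  simp_rw [hi, radField']
  have hn : ‖x‖ ^ 2 = x 0 ^ 2 + x 1 ^ 2 := by
    rw [EuclideanSpace.norm_sq_eq, Fin.sum_univ_two]; simp
  simp only [Fin.sum_univ_two, add_apply, smul_apply,
    ContinuousLinearMap.smulRight_apply, ContinuousLinearMap.id_apply, innerSL_apply_apply,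
    inner_add_left, EuclideanSpace.inner_single_right, conj_trivial]
  simp only [PiLp.smul_apply, smul_eq_mul, PiLp.single_apply]
  simp only [if_true]
  by_cases hx : x = 0
  · subst hx
    simp [radAvg_zero]
    ring
  · have hr : ‖x‖ ^ 2 ≠ 0 := pow_ne_zero 2 (norm_ne_zero_iff.2 hx)
    field_simp
    rw [hn]
    ring

/-- A radial profile yields a positive solution on the unit disc. -/
theorem RadialProfile.isPosSolution {k s p lam α : ℝ} {u : ℝ → ℝ}
    (h : RadialProfile k s (-lam) (p - 1) α u F) :
    IsPosSolution (Metric.ball (0 : Euc 2) 1) (fker 2 k s p) lam (fun x => u ‖x‖) := by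
  have hu := h.eq
  have hc := contDiff_radSol_norm h.cont α
  rw [← hu] at hc
  refine ⟨hc.contDiffOn, hc.continuous.continuousOn, fun x hx => ?_, fun x hx => ?_, fun x hx => ?_⟩
  · exact h.pos _ ⟨norm_nonneg x, mem_ball_zero_iff.1 hx⟩
  · rw [frontier_unitBall, mem_sphere_zero_iff_norm] at hx
    simp only [hx, h.zero]
  · have h1 := lap_radSol_norm h.cont α x
    rw [← hu] at h1
    have h2 := h.source ‖x‖ ⟨norm_nonneg x, (mem_ball_zero_iff.1 hx).le⟩
    rw [h1, h2]
    simp only [src, wt, fker, abs_norm]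
    ring

end RadialPDE

lemma exists_first_zero {f : ℝ → ℝ} (hf : Continuous f) {a : ℝ} (h0 : 0 < f 0) (ha : 0 ≤ a)
    (h1 : f a ≤ 0) : ∃ R ∈ Ioc 0 a, f R = 0 ∧ ∀ r ∈ Ico 0 R, 0 < f r := by
  have hcl : IsCompact (Icc 0 a ∩ f ⁻¹' Iic 0) :=
    isCompact_Icc.inter_right (isClosed_Iic.preimage hf)
  obtain ⟨R, ⟨⟨hR0, hR1⟩, hfR⟩, hmin⟩ := hcl.exists_isLeast ⟨a, ⟨⟨ha, le_rfl⟩, h1⟩⟩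
  have hpos : ∀ r ∈ Ico 0 R, 0 < f r := fun r hr => by
    by_contra! hn
    exact absurd (hmin ⟨⟨hr.1, hr.2.le.trans hR1⟩, hn⟩) (not_le.2 hr.2)
  have hR : 0 < R := by
    rcases hR0.eq_or_lt with h | h
    · rw [← h] at hfR
      exact absurd h0 (not_lt.2 hfR)
    · exact h
  refine ⟨R, ⟨hR, hR1⟩, le_antisymm hfR ?_, hpos⟩
  have ht : Tendsto f (𝓝[<] R) (𝓝 (f R)) := hf.continuousAt.tendsto.mono_left inf_le_left
  refine ge_of_tendsto ht ?_
  filter_upwards [Ioo_mem_nhdsLT hR] with r hr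
  exact (hpos r ⟨hr.1.le, hr.2⟩).le

section Cutoff

/-- A continuous ramp equal to `0` below `ε` and to `1` above `2ε`. -/
def ramp (ε t : ℝ) : ℝ := min 1 (max 0 (t / ε - 1))

/-- The primitive of the ramp. -/
def cutoff (ε t : ℝ) : ℝ := ∫ τ in (0:ℝ)..t, ramp ε τ

variable {ε : ℝ}

lemma continuous_ramp (ε : ℝ) : Continuous (ramp ε) :=
  continuous_const.min (continuous_const.max (by fun_prop))

lemma ramp_nonneg (t : ℝ) : 0 ≤ ramp ε t := le_min zero_le_one (le_max_left _ _)

lemma ramp_le_one (t : ℝ) : ramp ε t ≤ 1 := min_le_left _ _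

lemma ramp_eq_zero (hε : 0 < ε) {t : ℝ} (ht : t ≤ ε) : ramp ε t = 0 := by
  have : t / ε - 1 ≤ 0 := by rw [sub_nonpos, div_le_one hε]; exact ht
  rw [ramp, max_eq_left this, min_eq_right zero_le_one]

lemma ramp_eq_one (hε : 0 < ε) {t : ℝ} (ht : 2 * ε ≤ t) : ramp ε t = 1 := by
  have : 1 ≤ t / ε - 1 := by
    have := (le_div_iff₀ hε).2 ht
    linarith
  rw [ramp, max_eq_right (by linarith), min_eq_left this]

lemma hasDerivAt_cutoff (t : ℝ) : HasDerivAt (cutoff ε) (ramp ε t) t :=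
  ((continuous_ramp ε).integral_hasStrictDerivAt 0 t).hasDerivAt

lemma contDiff_cutoff : ContDiff ℝ 1 (cutoff ε) := by
  rw [contDiff_one_iff_deriv]
  refine ⟨fun t => (hasDerivAt_cutoff t).differentiableAt, ?_⟩
  have : deriv (cutoff ε) = ramp ε := funext fun t => (hasDerivAt_cutoff t).deriv
  rw [this]
  exact continuous_ramp ε

lemma cutoff_eq_zero (hε : 0 < ε) {t : ℝ} (ht : t ≤ ε) : cutoff ε t = 0 := by
  have : ∀ τ ∈ uIcc 0 t, ramp ε τ = 0 := fun τ hτ => ramp_eq_zero hε <|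
    (hτ.2).trans (max_le hε.le ht)
  rw [cutoff, intervalIntegral.integral_congr (g := fun _ => 0) this]
  simp

lemma cutoff_nonneg {t : ℝ} (ht : 0 ≤ t) : 0 ≤ cutoff ε t :=
  intervalIntegral.integral_nonneg ht fun τ _ => ramp_nonneg τ

lemma sub_le_cutoff (hε : 0 < ε) {t : ℝ} (ht : 0 ≤ t) : t - 2 * ε ≤ cutoff ε t := by
  rcases le_total t (2 * ε) with h | h
  · exact (sub_nonpos.2 h).trans (cutoff_nonneg ht)
  · have h1 := intervalIntegral.integral_add_adjacent_intervals
      ((continuous_ramp ε).intervalIntegrable (μ := volume) 0 (2 * ε))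
      ((continuous_ramp ε).intervalIntegrable (2 * ε) t)
    have h2 : ∫ τ in (2 * ε)..t, ramp ε τ = ∫ τ in (2 * ε)..t, (1:ℝ) :=
      intervalIntegral.integral_congr fun τ hτ => by
        rw [uIcc_of_le h] at hτ
        exact ramp_eq_one hε hτ.1
    have h3 : 0 ≤ cutoff ε (2 * ε) := cutoff_nonneg (by positivity)
    rw [h2, intervalIntegral.integral_const, smul_eq_mul, mul_one] at h1
    unfold cutoff at h3 ⊢
    linarith

lemma sq_sub_le_cutoff_sq (hε : 0 < ε) {t : ℝ} (ht : 0 ≤ t) :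
    t ^ 2 - 4 * ε * t ≤ cutoff ε t ^ 2 := by
  rcases le_total t (2 * ε) with h | h
  · nlinarith [sq_nonneg (cutoff ε t)]
  · have := sub_le_cutoff hε ht
    nlinarith

end Cutoff

lemma integral_norm_eq_of_eq_zero {f : ℝ → ℝ} {R : ℝ} (hR : 0 ≤ R) (hf : ∀ r, R ≤ r → f r = 0) :
    ∫ x : Euc 2, f ‖x‖ = 2 * (volume.real (Metric.ball (0 : Euc 2) 1)
      * ∫ r in (0:ℝ)..R, r * f r) := by
  rw [integral_fun_norm_addHaar]
  simp only [finrank_euclideanSpace, Fintype.card_fin, smul_eq_mul, nsmul_eq_mul,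
    Nat.add_one_sub_one, pow_one]
  rw [intervalIntegral.integral_of_le hR,
    ← setIntegral_eq_of_subset_of_forall_sdiff_eq_zero measurableSet_Ioi (Ioc_subset_Ioi_self)]
  · norm_num
  · intro r hr
    have h1 : (0:ℝ) < r := hr.1
    have h2 : R ≤ r := by
      by_contra! h
      exact hr.2 ⟨h1, h.le⟩
    rw [hf r h2, mul_zero]

/-- The Rayleigh inequality on a disc of radius `R ≤ 1` for a radial function vanishing at `R`. -/
theorem firstEig_mul_le_radial {F : ℝ → ℝ} (hF : Continuous F) {α R : ℝ} (hR : 0 < R)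
    (hR1 : R ≤ 1) (hpos : ∀ r ∈ Ico 0 R, 0 < radSol F α r) (hneg : ∀ r, R ≤ r → radSol F α r ≤ 0)
    (hl : 0 ≤ firstEig (Metric.ball (0 : Euc 2) 1)) :
    firstEig (Metric.ball (0 : Euc 2) 1) * ∫ r in (0:ℝ)..R, r * radSol F α r ^ 2
      ≤ ∫ r in (0:ℝ)..R, r * (r * radAvg F r) ^ 2 := by
  set l := firstEig (Metric.ball (0 : Euc 2) 1) with hldef
  set u := radSol F α with hu
  have huc : Continuous u := continuous_radSol hF α
  have hgc : Continuous (radAvg F) := continuous_radAvg hF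
  have hu0 : ∀ r ∈ Icc 0 R, 0 ≤ u r := by
    intro r hr
    rcases hr.2.lt_or_eq with h | h
    · exact (hpos r ⟨hr.1, h⟩).le
    · rw [h]
      have ht : Tendsto u (𝓝[<] R) (𝓝 (u R)) := huc.continuousAt.tendsto.mono_left inf_le_left
      refine ge_of_tendsto ht ?_
      filter_upwards [Ioo_mem_nhdsLT hR] with r hr
      exact (hpos r ⟨hr.1.le, hr.2⟩).le
  have hmain : ∀ ε > 0, l * ∫ r in (0:ℝ)..R, r * (u r ^ 2 - 4 * ε * u r)
      ≤ ∫ r in (0:ℝ)..R, r * (r * radAvg F r) ^ 2 := by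
    intro ε hε
    obtain ⟨R', hR'R, hR'⟩ : ∃ R' < R, ∀ r, R' ≤ r → u r ≤ ε := by
      have : ∀ᶠ r in 𝓝 R, u r < ε :=
        huc.continuousAt.eventually (gt_mem_nhds ((hneg R le_rfl).trans_lt hε))
      obtain ⟨η, hη, hb⟩ := Metric.eventually_nhds_iff.1 this
      refine ⟨R - η / 2, by linarith, fun r hr => ?_⟩
      rcases le_total R r with h | h
      · exact (hneg r h).trans hε.le
      · refine (hb ?_).le
        rw [Real.dist_eq, abs_lt]
        constructor <;> linarith
    have hV : ContDiff ℝ 1 fun x : Euc 2 => cutoff ε (u ‖x‖) :=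
      contDiff_cutoff.comp ((contDiff_radSol_norm hF α).of_le (by norm_num))
    have hray := firstEig_mul_le_of_contDiff (hR'R.trans_le hR1) hV
      fun x hx => cutoff_eq_zero hε (hR' _ hx)
    have hdV : ∀ x : Euc 2, ‖fderiv ℝ (fun x : Euc 2 => cutoff ε (u ‖x‖)) x‖ ^ 2
        = (ramp ε (u ‖x‖) * (‖x‖ * radAvg F ‖x‖)) ^ 2 := by
      intro x
      have h1 := (hasDerivAt_cutoff (ε := ε) (u ‖x‖)).comp_hasFDerivAt x
        (hasFDerivAt_radSol_norm hF α x)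
      have h2 : fderiv ℝ (fun x : Euc 2 => cutoff ε (u ‖x‖)) x = _ := h1.fderiv
      rw [h2, norm_smul, norm_neg, innerSL_apply_norm, norm_smul, mul_pow, mul_pow, mul_pow, mul_pow,
        Real.norm_eq_abs, Real.norm_eq_abs, sq_abs, sq_abs]
      ring
    simp_rw [hdV] at hray
    rw [integral_norm_eq_of_eq_zero hR.le (f := fun r => cutoff ε (u r) ^ 2)
        (fun r hr => by simp only [cutoff_eq_zero hε (hR' r (hR'R.le.trans hr))]; norm_num),
      integral_norm_eq_of_eq_zero hR.le (f := fun r => (ramp ε (u r) * (r * radAvg F r)) ^ 2)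
        (fun r hr => by simp only [ramp_eq_zero hε (hR' r (hR'R.le.trans hr))]; norm_num),
      mul_left_comm, mul_left_comm l] at hray
    have hvol : 0 < volume.real (Metric.ball (0 : Euc 2) 1) := by
      rw [measureReal_def]
      exact ENNReal.toReal_pos (Metric.measure_ball_pos _ _ one_pos).ne' measure_ball_lt_top.ne
    have hray2 := le_of_mul_le_mul_left (le_of_mul_le_mul_left hray two_pos) hvol
    have hcc : Continuous fun r => cutoff ε (u r) := contDiff_cutoff.continuous.comp huc
    have hrc : Continuous fun r => ramp ε (u r) := (continuous_ramp ε).comp huc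
    refine le_trans (mul_le_mul_of_nonneg_left ?_ hl) (hray2.trans ?_)
    · refine intervalIntegral.integral_mono_on hR.le
        (Continuous.intervalIntegrable (by fun_prop) _ _)
        (Continuous.intervalIntegrable (by fun_prop) _ _) fun r hr => ?_
      exact mul_le_mul_of_nonneg_left (sq_sub_le_cutoff_sq hε (hu0 r hr)) hr.1
    · refine intervalIntegral.integral_mono_on hR.le
        (Continuous.intervalIntegrable (by fun_prop) _ _)
        (Continuous.intervalIntegrable (by fun_prop) _ _) fun r hr => ?_
      refine mul_le_mul_of_nonneg_left ?_ hr.1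
      rw [mul_pow]
      refine mul_le_of_le_one_left (sq_nonneg _) ?_
      exact pow_le_one₀ (ramp_nonneg _) (ramp_le_one _)
  set K := l * (4 * ∫ r in (0:ℝ)..R, r * u r) with hK
  have hK0 : 0 ≤ K := by
    refine mul_nonneg hl (mul_nonneg (by norm_num) ?_)
    exact intervalIntegral.integral_nonneg hR.le fun r hr => mul_nonneg hr.1 (hu0 r hr)
  refine le_of_forall_pos_le_add fun η hη => ?_
  have h1 := hmain (η / (K + 1)) (by positivity)
  have h2 : ∫ r in (0:ℝ)..R, r * (u r ^ 2 - 4 * (η / (K + 1)) * u r)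
      = (∫ r in (0:ℝ)..R, r * u r ^ 2) - (η / (K + 1)) * (4 * ∫ r in (0:ℝ)..R, r * u r) := by
    rw [← intervalIntegral.integral_const_mul, ← intervalIntegral.integral_const_mul,
      ← intervalIntegral.integral_sub (Continuous.intervalIntegrable (by fun_prop) _ _)
        (Continuous.intervalIntegrable (by fun_prop) _ _)]
    congr 1
    ext r
    ring
  rw [h2] at h1
  have h3 : η / (K + 1) * K ≤ η := by
    rw [div_mul_eq_mul_div, div_le_iff₀ (by linarith)]
    nlinarith
  have h4 : l * ((η / (K + 1)) * (4 * ∫ r in (0:ℝ)..R, r * u r)) = η / (K + 1) * K := by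
    rw [hK]; ring
  rw [mul_sub, h4] at h1
  linarith

lemma le_of_hasDerivAt_nonneg {f f' : ℝ → ℝ} {a b : ℝ} (hab : a ≤ b)
    (hd : ∀ x ∈ Icc a b, HasDerivAt f (f' x) x) (h0 : ∀ x ∈ Ioo a b, 0 ≤ f' x) : f a ≤ f b := by
  refine monotoneOn_of_deriv_nonneg (convex_Icc a b)
    (fun x hx => (hd x hx).continuousAt.continuousWithinAt) ?_ ?_ ⟨le_rfl, hab⟩ ⟨hab, le_rfl⟩ hab
  · rw [interior_Icc]
    exact fun y hy => (hd y (Ioo_subset_Icc_self hy)).differentiableAt.differentiableWithinAt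
  · rw [interior_Icc]
    exact fun y hy => (h0 y hy).trans_eq (hd y (Ioo_subset_Icc_self hy)).deriv.symm

lemma radAvg_nonneg {F : ℝ → ℝ} {r : ℝ} (hr : 0 ≤ r) (h : ∀ σ ∈ Icc 0 r, 0 ≤ F σ) :
    0 ≤ radAvg F r :=
  intervalIntegral.integral_nonneg zero_le_one fun _ ht =>
    mul_nonneg ht.1 (h _ ⟨mul_nonneg ht.1 hr, mul_le_of_le_one_left hr ht.2⟩)

lemma radAvg_pos {F : ℝ → ℝ} (hF : Continuous F) {r : ℝ} (hr : 0 ≤ r)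
    (h : ∀ σ ∈ Icc 0 r, 0 ≤ F σ) (h0 : 0 < F 0) : 0 < radAvg F r := by
  have hev : ∀ᶠ t in 𝓝[>] (0:ℝ), 0 < F (t * r) := by
    have : Tendsto (fun t => F (t * r)) (𝓝 0) (𝓝 (F (0 * r))) :=
      Continuous.tendsto (by fun_prop) 0
    rw [zero_mul] at this
    exact (this.eventually (lt_mem_nhds h0)).filter_mono nhdsWithin_le_nhds
  obtain ⟨t, ht, ht1⟩ := (hev.and (Ioo_mem_nhdsGT (zero_lt_one (α := ℝ)))).exists
  refine intervalIntegral.integral_pos zero_lt_one (by fun_prop) ?_ ⟨t, Ioo_subset_Icc_self ht1,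
    mul_pos ht1.1 ht⟩
  exact fun t ht => mul_nonneg ht.1.le
    (h _ ⟨mul_nonneg ht.1.le hr, mul_le_of_le_one_left hr ht.2⟩)

lemma strictAntiOn_radSol {F : ℝ → ℝ} (hF : Continuous F) {α a : ℝ}
    (h : ∀ σ ∈ Icc 0 a, 0 ≤ F σ) (h0 : 0 < F 0) : StrictAntiOn (radSol F α) (Icc 0 a) := by
  refine strictAntiOn_of_deriv_neg (convex_Icc 0 a) (continuous_radSol hF α).continuousOn ?_
  intro r hr
  rw [interior_Icc] at hr
  rw [(hasDerivAt_radSol hF α r).deriv, neg_neg_iff_pos]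
  exact mul_pos hr.1 (radAvg_pos hF hr.1.le (fun σ hσ => h σ ⟨hσ.1, hσ.2.trans hr.2.le⟩) h0)

/-- Truncation of a real number to the interval `[0, M]`. -/
def clip (M t : ℝ) : ℝ := max 0 (min t M)

lemma clip_nonneg (M t : ℝ) : 0 ≤ clip M t := le_max_left _ _

lemma clip_le {M : ℝ} (hM : 0 ≤ M) (t : ℝ) : clip M t ≤ M := max_le hM (min_le_right _ _)

lemma clip_eq {M t : ℝ} (h0 : 0 ≤ t) (h : t ≤ M) : clip M t = t := by
  rw [clip, min_eq_left h, max_eq_right h0]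

lemma clip_le_of_le {M t a : ℝ} (ha : 0 ≤ a) (h : t ≤ a) : clip M t ≤ a :=
  max_le ha ((min_le_left _ _).trans h)

lemma abs_clip_sub_le (M a b : ℝ) : |clip M a - clip M b| ≤ |a - b| := by
  refine (abs_max_sub_max_le_max _ _ _ _).trans (max_le (by simp) ?_)
  exact (abs_min_sub_min_le_max _ _ _ _).trans (max_le le_rfl (by simp))

lemma continuous_clip (M : ℝ) : Continuous (clip M) :=
  continuous_const.max (continuous_id.min continuous_const)

section

variable {k s μ q M α : ℝ}

lemma src_nonneg {r t : ℝ} (hμ : 0 ≤ μ) (ht : 0 ≤ t) : 0 ≤ src k s μ q r t :=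
  add_nonneg (mul_nonneg hμ ht) (mul_nonneg (wt_pos k s r).le (Real.rpow_nonneg ht q))

lemma continuous_src_clip (hk : 0 ≤ k) (s μ : ℝ) (hq : 0 ≤ q) (M : ℝ) :
    Continuous fun z : ℝ × ℝ => src k s μ q z.1 (clip M z.2) := by
  have h1 := (continuous_wt hk s).comp (continuous_fst (X := ℝ) (Y := ℝ))
  have h2 := (continuous_clip M).comp (continuous_snd (X := ℝ) (Y := ℝ))
  exact (continuous_const.mul h2).add (h1.mul (h2.rpow_const fun _ => Or.inr hq))

lemma abs_src_clip_sub_le (hs : 0 ≤ s) (hμ : 0 ≤ μ) (hq : 1 ≤ q) (hM : 0 ≤ M) (r a b : ℝ) :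
    |src k s μ q r (clip M a) - src k s μ q r (clip M b)|
      ≤ (μ + q * M ^ (q - 1)) * |a - b| := by
  have key : ∀ t t', 0 ≤ t → t ≤ t' → t' ≤ M →
      |src k s μ q r t' - src k s μ q r t| ≤ (μ + q * M ^ (q - 1)) * |t' - t| := by
    intro t t' ht htt' htM
    have e1 := rpow_sub_rpow_le hq ht htt'
    have e2 : t' ^ (q - 1) ≤ M ^ (q - 1) :=
      Real.rpow_le_rpow (ht.trans htt') htM (by linarith)
    have hd : 0 ≤ t' - t := by linarith
    have e3 : t' ^ q - t ^ q ≤ q * M ^ (q - 1) * (t' - t) := e1.trans (by gcongr)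
    have e6 : 0 ≤ t' ^ q - t ^ q := sub_nonneg.2 (Real.rpow_le_rpow ht htt' (by linarith))
    have e4 := wt_le_one hs k r
    have e5 := wt_pos k s r
    have e7 : src k s μ q r t' - src k s μ q r t = μ * (t' - t) + wt k s r * (t' ^ q - t ^ q) := by
      unfold src; ring
    rw [e7, abs_of_nonneg hd, abs_of_nonneg (by positivity)]
    nlinarith
  have hL : 0 ≤ μ + q * M ^ (q - 1) := by have := Real.rpow_nonneg hM (q - 1); positivity
  refine le_trans ?_ (mul_le_mul_of_nonneg_left (abs_clip_sub_le M a b) hL)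
  rcases le_total (clip M a) (clip M b) with h | h
  · rw [abs_sub_comm, abs_sub_comm (clip M a)]
    exact key _ _ (clip_nonneg _ _) h (clip_le hM _)
  · exact key _ _ (clip_nonneg _ _) h (clip_le hM _)

/-- A solution of the radial equation with truncated nonlinearity, starting from height `α`. -/
structure Shot (k s μ q M α : ℝ) (F : ℝ → ℝ) : Prop where
  cont : Continuous F
  nonneg : ∀ r, 0 ≤ F r
  source : ∀ r ∈ Icc (0:ℝ) 1, F r = src k s μ q r (clip M (radSol F α r))

lemma exists_shots (hs : 0 ≤ s) (hk : 0 ≤ k) (hμ : 0 < μ) (hq : 1 ≤ q) (hM : 0 ≤ M) :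
    ∃ (F : ℝ → ℝ → ℝ) (C : ℝ), (∀ α, Shot k s μ q M α (F α)) ∧
      (∀ α β, |radSol (F α) α 1 - radSol (F β) β 1| ≤ C * |α - β|) ∧
      ∀ α φ, ContinuousOn φ (Icc 0 1) →
        (∀ r ∈ Icc (0:ℝ) 1, φ r = radSol (fun σ => src k s μ q σ (clip M (φ σ))) α r) →
        ∀ r ∈ Icc (0:ℝ) 1, φ r = radSol (F α) α r := by
  have hL : 0 < μ + q * M ^ (q - 1) := by have := Real.rpow_nonneg hM (q - 1); positivity
  obtain ⟨U, C, h1, h2, h3, h4⟩ := exists_radial_flow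
    (Φ := fun r t => src k s μ q r (clip M t)) (continuous_src_clip hk s μ (by linarith) M) hL
    (abs_src_clip_sub_le hs hμ.le hq hM)
  have h1' : (1:ℝ) ∈ Icc (0:ℝ) 1 := ⟨zero_le_one, le_rfl⟩
  refine ⟨fun α σ => src k s μ q σ (clip M (U α σ)), C, fun α => ⟨?_, ?_, ?_⟩, ?_, ?_⟩
  · exact (continuous_src_clip hk s μ (by linarith) M).comp (continuous_id.prodMk (h1 α))
  · exact fun r => src_nonneg hμ.le (clip_nonneg _ _)
  · intro r hr
    simp only [← h2 α r hr]
  · intro α β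
    simp only [← h2 _ 1 h1']
    exact h3 α β
  · intro α φ hφ he r hr
    rw [h4 α φ hφ he r hr, h2 α r hr]

namespace Shot

variable {F : ℝ → ℝ}

lemma apply_zero_pos (h : Shot k s μ q M α F) (hμ : 0 < μ) (hα : 0 < α) (hαM : α ≤ M) :
    0 < F 0 := by
  rw [h.source 0 ⟨le_rfl, zero_le_one⟩, radSol_zero, clip_eq hα.le hαM]
  exact src_pos hμ hα

lemma strictAntiOn (h : Shot k s μ q M α F) (hμ : 0 < μ) (hα : 0 < α) (hαM : α ≤ M) (a : ℝ) :
    StrictAntiOn (radSol F α) (Icc 0 a) :=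
  strictAntiOn_radSol h.cont (fun σ _ => h.nonneg σ) (h.apply_zero_pos hμ hα hαM)

lemma le_height (h : Shot k s μ q M α F) {r : ℝ} (hr : 0 ≤ r) : radSol F α r ≤ α := by
  have := le_of_hasDerivAt_nonneg hr (f := fun r => -radSol F α r)
    (fun x _ => (hasDerivAt_radSol h.cont α x).neg) fun x hx => by
      have := radAvg_nonneg hx.1.le fun σ _ => h.nonneg σ
      have := hx.1
      rw [neg_neg]; positivity
  simp only [radSol_zero] at this
  linarith

lemma source_of_nonneg (h : Shot k s μ q M α F) (hαM : α ≤ M) {r : ℝ}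
    (hr : r ∈ Icc (0:ℝ) 1) (hu : 0 ≤ radSol F α r) : F r = src k s μ q r (radSol F α r) := by
  rw [h.source r hr, clip_eq hu ((h.le_height hr.1).trans hαM)]

lemma integral_energy (hF : Continuous F) {R : ℝ} (hR : radSol F α R = 0) :
    ∫ r in (0:ℝ)..R, r * (r * radAvg F r) ^ 2 = ∫ r in (0:ℝ)..R, r * F r * radSol F α r := by
  have hg := continuous_radAvg hF
  have hu := continuous_radSol hF α
  have key : ∫ r in (0:ℝ)..R, (r * F r * radSol F α r - r * (r * radAvg F r) ^ 2)
      = R ^ 2 * radAvg F R * radSol F α R - 0 ^ 2 * radAvg F 0 * radSol F α 0 := by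
    refine intervalIntegral.integral_eq_sub_of_hasDerivAt
      (f := fun r => r ^ 2 * radAvg F r * radSol F α r) (fun r _ => ?_) ?_
    · refine ((hasDerivAt_sq_mul_radAvg hF r).mul (hasDerivAt_radSol hF α r)).congr_deriv ?_
      ring
    · exact Continuous.intervalIntegrable (by fun_prop) _ _
  rw [intervalIntegral.integral_sub (Continuous.intervalIntegrable (by fun_prop) _ _)
    (Continuous.intervalIntegrable (by fun_prop) _ _), hR] at key
  linarith

lemma pos_at_one (h : Shot k s μ q M α F) (hs : 0 ≤ s) (hμ : 0 < μ) (hq : 1 < q) (hα : 0 < α)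
    (hαM : α ≤ M) (hsmall : μ + α ^ (q - 1) < firstEig (Metric.ball (0 : Euc 2) 1)) :
    0 < radSol F α 1 := by
  by_contra! hneg
  have hF := h.cont
  have hu := continuous_radSol hF α
  obtain ⟨R, hR, hR0, hRpos⟩ := exists_first_zero hu (by simpa using hα) zero_le_one hneg
  set l := firstEig (Metric.ball (0 : Euc 2) 1) with hl
  have hαq := Real.rpow_nonneg hα.le (q - 1)
  have h1 := firstEig_mul_le_radial hF hR.1 hR.2 hRpos (fun r hr => by
    rw [← hR0]
    exact (h.strictAntiOn hμ hα hαM r).antitoneOn ⟨hR.1.le, hr⟩ ⟨hR.1.le.trans hr, le_rfl⟩ hr)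
    (by linarith)
  rw [integral_energy hF hR0] at h1
  have h2 : ∫ r in (0:ℝ)..R, r * F r * radSol F α r
      ≤ ∫ r in (0:ℝ)..R, (μ + α ^ (q - 1)) * (r * radSol F α r ^ 2) := by
    refine intervalIntegral.integral_mono_on hR.1.le
      (Continuous.intervalIntegrable (by fun_prop) _ _)
      (Continuous.intervalIntegrable (by fun_prop) _ _) fun r hr => ?_
    have hu0 : 0 ≤ radSol F α r := by
      rcases hr.2.eq_or_lt with rfl | hlt
      · exact hR0.ge
      · exact (hRpos r ⟨hr.1, hlt⟩).le
    rw [h.source_of_nonneg hαM ⟨hr.1, hr.2.trans hR.2⟩ hu0]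
    set t := radSol F α r with ht
    have e1 : t ^ q ≤ α ^ (q - 1) * t := by
      rcases hu0.eq_or_lt with h0 | h0
      · rw [← h0, Real.zero_rpow (by linarith)]; simp
      · rw [show t ^ q = t ^ (q - 1) * t by rw [← Real.rpow_add_one h0.ne', sub_add_cancel]]
        have := Real.rpow_le_rpow hu0 (h.le_height hr.1) (by linarith : 0 ≤ q - 1)
        gcongr
    have e2 := wt_le_one hs k r
    have e3 := wt_pos k s r
    have e4 := Real.rpow_nonneg hu0 q
    have e5 : src k s μ q r t ≤ (μ + α ^ (q - 1)) * t := by unfold src; nlinarith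
    calc r * src k s μ q r t * t ≤ r * ((μ + α ^ (q - 1)) * t) * t := by
          have := hr.1; gcongr
      _ = _ := by ring
  rw [intervalIntegral.integral_const_mul] at h2
  have h3 : 0 < ∫ r in (0:ℝ)..R, r * radSol F α r ^ 2 := by
    refine intervalIntegral.intervalIntegral_pos_of_pos_on
      (Continuous.intervalIntegrable (by fun_prop) _ _) (fun r hr => ?_) hR.1
    have := hRpos r ⟨hr.1.le, hr.2⟩
    have := hr.1
    positivity
  nlinarith

end Shot

end

lemma wt_ge {k s r : ℝ} (hk : 0 ≤ k) (hs : 0 ≤ s) (hr : r ∈ Icc (0:ℝ) 1) :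
    (2:ℝ) ^ (-s) ≤ wt k s r := by
  have h := wt_anti hk hs hr.1 hr.2
  rwa [wt, abs_one, Real.one_rpow, one_add_one_eq_two] at h

namespace Shot

variable {k s μ q M α : ℝ} {F : ℝ → ℝ}

lemma sub_le_radSol (hF : Continuous F) {B r : ℝ} (hr : 0 ≤ r)
    (hB : ∀ σ ∈ Icc 0 r, F σ ≤ B) : α - B * r ^ 2 / 4 ≤ radSol F α r := by
  have h1 : ∀ x ∈ Icc 0 r, x ^ 2 * radAvg F x ≤ B * x ^ 2 / 2 := by
    intro x hx
    have := le_of_hasDerivAt_nonneg hx.1 (f := fun x => B * x ^ 2 / 2 - x ^ 2 * radAvg F x)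
      (f' := fun x => B * x - x * F x) (fun y _ => ?_) fun y hy => ?_
    · simp only [ne_eq, OfNat.ofNat_ne_zero, not_false_eq_true, zero_pow, mul_zero, zero_div,
        zero_mul, sub_self] at this
      linarith
    · refine ((((hasDerivAt_pow 2 y).const_mul B).div_const 2).sub
        (hasDerivAt_sq_mul_radAvg hF y)).congr_deriv ?_
      simp; ring
    · have := mul_le_mul_of_nonneg_left (hB y ⟨hy.1.le, hy.2.le.trans hx.2⟩) hy.1.le
      linarith
  have := le_of_hasDerivAt_nonneg hr (f := fun x => radSol F α x + B * x ^ 2 / 4)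
    (f' := fun x => -(x * radAvg F x) + B * x / 2) (fun y _ => ?_) fun y hy => ?_
  · simp only [radSol_zero, ne_eq, OfNat.ofNat_ne_zero, not_false_eq_true, zero_pow, mul_zero,
      zero_div, add_zero] at this
    linarith
  · refine ((hasDerivAt_radSol hF α y).add
      (((hasDerivAt_pow 2 y).const_mul B).div_const 4)).congr_deriv ?_
    simp; ring
  · have h2 := h1 y (Ioo_subset_Icc_self hy)
    have : y * (y * radAvg F y) ≤ y * (B * y / 2) := by linarith
    have := le_of_mul_le_mul_left this hy.1
    linarith

lemma sq_mul_radAvg_ge (hF : Continuous F) {b r₀ r : ℝ} (hr₀ : 0 ≤ r₀) (hr : r₀ ≤ r)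
    (hpos : ∀ r, 0 ≤ F r) (hb : ∀ σ ∈ Icc 0 r₀, b ≤ F σ) :
    b * r₀ ^ 2 / 2 ≤ r ^ 2 * radAvg F r := by
  have h1 := le_of_hasDerivAt_nonneg hr (fun x _ => hasDerivAt_sq_mul_radAvg hF x)
    fun x hx => mul_nonneg (hr₀.trans hx.1.le) (hpos x)
  have h2 := le_of_hasDerivAt_nonneg hr₀ (f := fun x => x ^ 2 * radAvg F x - b * x ^ 2 / 2)
      (f' := fun x => x * F x - b * x) (fun y _ => ?_) fun y hy => ?_
  · simp only [ne_eq, OfNat.ofNat_ne_zero, not_false_eq_true, zero_pow, mul_zero, zero_div,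
        zero_mul, sub_self] at h2
    linarith
  · refine ((hasDerivAt_sq_mul_radAvg hF y).sub
      (((hasDerivAt_pow 2 y).const_mul b).div_const 2)).congr_deriv ?_
    simp; ring
  · have := mul_le_mul_of_nonneg_left (hb y (Ioo_subset_Icc_self hy)) hy.1.le
    linarith

lemma nonpos_at_one {T : ℝ} (h : Shot k s μ q M (Real.exp T) F) (hs : 0 ≤ s) (hk : 0 ≤ k)
    (hμ : 0 < μ) (hq : 1 < q) (hαM : Real.exp T ≤ M) (hT : 0 ≤ T)
    (hT1 : μ ≤ Real.exp (T * (q - 1)))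
    (hT2 : 2 ≤ (2:ℝ) ^ (-s) * 2 ^ (-q) / 2 * (q - 1) * T) :
    radSol F (Real.exp T) 1 ≤ 0 := by
  set α := Real.exp T with hα
  set c := (2:ℝ) ^ (-s) * 2 ^ (-q) / 2 with hc
  have hF := h.cont
  have hα0 : 0 < α := Real.exp_pos T
  have hαq : α ^ q = α * Real.exp (T * (q - 1)) := by
    rw [hα, ← Real.exp_mul, ← Real.exp_add]; ring_nf
  set r₀ := Real.exp (-(T * (q - 1) / 2)) with hr₀
  have hr₀0 : 0 < r₀ := Real.exp_pos _
  have hTq : 0 ≤ T * (q - 1) := mul_nonneg hT (by linarith)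
  have hr₀1 : r₀ ≤ 1 := Real.exp_le_one_iff.2 (by linarith)
  have hr₀2 : α ^ q * r₀ ^ 2 = α := by
    rw [hαq, hr₀, ← Real.exp_nat_mul, mul_assoc, ← Real.exp_add]
    push_cast
    ring_nf; simp
  have hB : ∀ σ ∈ Icc (0:ℝ) 1, F σ ≤ 2 * α ^ q := by
    intro σ hσ
    rw [h.source σ hσ]
    have h0 := clip_nonneg M (radSol F α σ)
    have h1 := clip_le_of_le (M := M) hα0.le (h.le_height hσ.1)
    have h2 := Real.rpow_le_rpow h0 h1 (by linarith : 0 ≤ q)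
    have h3 := wt_le_one hs k σ
    have h4 := wt_pos k s σ
    have h5 : μ * α ≤ α ^ q := by rw [hαq]; nlinarith
    have h6 := Real.rpow_nonneg h0 q
    unfold src
    nlinarith
  have hhalf : ∀ r ∈ Icc 0 r₀, α / 2 ≤ radSol F α r := by
    intro r hr
    have h1 := sub_le_radSol (α := α) hF hr.1 fun σ hσ => hB σ ⟨hσ.1, hσ.2.trans (hr.2.trans hr₀1)⟩
    have h2 : r ^ 2 ≤ r₀ ^ 2 := by have := hr.1; have := hr.2; gcongr
    have h3 := mul_le_mul_of_nonneg_left h2 (Real.rpow_nonneg hα0.le q)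
    linarith
  have hlow : ∀ σ ∈ Icc 0 r₀, (2:ℝ) ^ (-s) * (α / 2) ^ q ≤ F σ := by
    intro σ hσ
    have hσ1 : σ ∈ Icc (0:ℝ) 1 := ⟨hσ.1, hσ.2.trans hr₀1⟩
    have h1 := hhalf σ hσ
    have h2 : 0 ≤ radSol F α σ := by linarith
    rw [h.source_of_nonneg hαM hσ1 h2]
    have h3 := wt_ge hk hs hσ1
    have h4 := wt_pos k s σ
    have h5 : (α / 2) ^ q ≤ radSol F α σ ^ q := Real.rpow_le_rpow (by linarith) h1 (by linarith)
    have h6 : 0 ≤ (α / 2) ^ q := Real.rpow_nonneg (by linarith) q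
    have h7 : (2:ℝ) ^ (-s) * (α / 2) ^ q ≤ wt k s σ * radSol F α σ ^ q := by gcongr
    have h8 := mul_nonneg hμ.le h2
    unfold src
    linarith
  have hcα : (2:ℝ) ^ (-s) * (α / 2) ^ q * r₀ ^ 2 / 2 = c * α := by
    rw [Real.div_rpow hα0.le zero_le_two, hc, Real.rpow_neg zero_le_two q]
    calc _ = (2:ℝ) ^ (-s) * (2 ^ q)⁻¹ / 2 * (α ^ q * r₀ ^ 2) := by ring
      _ = _ := by rw [hr₀2]
  have hfin := le_of_hasDerivAt_nonneg hr₀1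
    (f := fun r => -(radSol F α r + c * α * Real.log r))
    (f' := fun r => -(-(r * radAvg F r) + c * α * r⁻¹)) (fun r hr => ?_) fun r hr => ?_
  · simp only [Real.log_one, mul_zero, add_zero] at hfin
    rw [hr₀, Real.log_exp, ← hr₀] at hfin
    have h1 := h.le_height hr₀0.le
    have h2 : c * (T * (q - 1) / 2) ≥ 1 := by linarith
    nlinarith
  · have hr0 : r ≠ 0 := (hr₀0.trans_le hr.1).ne'
    exact ((hasDerivAt_radSol hF α r).add ((Real.hasDerivAt_log hr0).const_mul (c * α))).neg
  · have hr0 : 0 < r := hr₀0.trans hr.1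
    have h1 := sq_mul_radAvg_ge hF hr₀0.le hr.1.le h.nonneg hlow
    rw [hcα] at h1
    have h2 : c * α * r⁻¹ ≤ r * radAvg F r := by
      rw [← div_eq_mul_inv, div_le_iff₀ hr0]
      linarith
    linarith

end Shot

theorem exists_radialProfile {k s μ q : ℝ} (hs : 0 ≤ s) (hk : 0 ≤ k) (hμ : 0 < μ) (hq : 1 < q)
    (hμ1 : μ < firstEig (Metric.ball (0 : Euc 2) 1)) :
    ∃ α u F, RadialProfile k s μ q α u F := by
  set l := firstEig (Metric.ball (0 : Euc 2) 1) with hl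
  set c := (2:ℝ) ^ (-s) * 2 ^ (-q) / 2 * (q - 1) with hc
  have hc0 : 0 < c := by have : 0 < q - 1 := by linarith
                         positivity
  have hq1 : 0 < q - 1 := by linarith
  obtain ⟨T, hT0, hT1, hT2⟩ : ∃ T : ℝ, 0 ≤ T ∧ μ ≤ Real.exp (T * (q - 1)) ∧ 2 ≤ c * T := by
    refine ⟨max (2 / c) (μ / (q - 1)), ?_, ?_, ?_⟩
    · exact le_max_of_le_left (by positivity)
    · have : μ ≤ max (2 / c) (μ / (q - 1)) * (q - 1) := by
        rw [← div_le_iff₀ hq1]; exact le_max_right _ _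
      linarith [Real.add_one_le_exp (max (2 / c) (μ / (q - 1)) * (q - 1))]
    · rw [mul_comm, ← div_le_iff₀ hc0]; exact le_max_left _ _
  set M := Real.exp T with hM
  have hM1 : 1 ≤ M := Real.one_le_exp hT0
  obtain ⟨F, C, hF, hC, -⟩ := exists_shots (k := k) hs hk hμ hq.le (by linarith : 0 ≤ M)
  obtain ⟨α₀, hα₀, hα₀M, hα₀l⟩ : ∃ α₀ : ℝ, 0 < α₀ ∧ α₀ ≤ M ∧ μ + α₀ ^ (q - 1) < l := by
    have h1 : Tendsto (fun a : ℝ => μ + a ^ (q - 1)) (𝓝 0) (𝓝 (μ + 0 ^ (q - 1))) :=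
      ((Real.continuous_rpow_const hq1.le).const_add μ).tendsto 0
    rw [Real.zero_rpow hq1.ne', add_zero] at h1
    have h2 := (h1.eventually (gt_mem_nhds hμ1)).filter_mono
      (nhdsWithin_le_nhds (s := Ioi (0:ℝ)))
    obtain ⟨a, ha, ha1⟩ := (h2.and (Ioo_mem_nhdsGT (zero_lt_one (α := ℝ)))).exists
    exact ⟨a, ha1.1, ha1.2.le.trans hM1, ha⟩
  have hcont : Continuous fun α => radSol (F α) α 1 := by
    refine (LipschitzWith.of_dist_le_mul (K := C.toNNReal) fun a b => ?_).continuous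
    rw [Real.dist_eq, Real.dist_eq]
    refine (hC a b).trans ?_
    gcongr
    exact Real.le_coe_toNNReal C
  have hpos := (hF α₀).pos_at_one hs hμ hq hα₀ hα₀M hα₀l
  have hneg := (hF M).nonpos_at_one hs hk hμ hq le_rfl hT0 hT1 hT2
  obtain ⟨α, hα, hα1⟩ := intermediate_value_Icc' hα₀M hcont.continuousOn ⟨hneg, hpos.le⟩
  have hα0 : 0 < α := hα₀.trans_le hα.1
  have hpos' : ∀ r ∈ Ico (0:ℝ) 1, 0 < radSol (F α) α r := fun r hr => by
    have := (hF α).strictAntiOn hμ hα0 hα.2 1 ⟨hr.1, hr.2.le⟩ ⟨zero_le_one, le_rfl⟩ hr.2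
    simpa only [hα1] using this
  refine ⟨α, _, F α, (hF α).cont, rfl, fun r hr => ?_, hpos', hα1⟩
  refine (hF α).source_of_nonneg hα.2 hr ?_
  rcases hr.2.eq_or_lt with rfl | hlt
  · exact hα1.ge
  · exact (hpos' r ⟨hr.1, hlt⟩).le

namespace RadialProfile

variable {k s μ q α : ℝ} {u F : ℝ → ℝ}

lemma height_pos (h : RadialProfile k s μ q α u F) : 0 < α := by
  have := h.pos 0 ⟨le_rfl, zero_lt_one⟩
  rwa [h.eq, radSol_zero] at this

lemma nonneg (h : RadialProfile k s μ q α u F) {r : ℝ} (hr : r ∈ Icc (0:ℝ) 1) : 0 ≤ u r := by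
  rcases hr.2.eq_or_lt with rfl | hlt
  · exact h.zero.ge
  · exact (h.pos r ⟨hr.1, hlt⟩).le

lemma source_nonneg (h : RadialProfile k s μ q α u F) (hμ : 0 < μ) :
    ∀ r ∈ Icc (0:ℝ) 1, 0 ≤ F r := fun r hr => by
  rw [h.source r hr]; exact src_nonneg hμ.le (h.nonneg hr)

lemma source_zero_pos (h : RadialProfile k s μ q α u F) (hμ : 0 < μ) : 0 < F 0 := by
  rw [h.source 0 ⟨le_rfl, zero_le_one⟩]
  exact src_pos hμ (h.pos 0 ⟨le_rfl, zero_lt_one⟩)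

lemma strictAntiOn (h : RadialProfile k s μ q α u F) (hμ : 0 < μ) :
    StrictAntiOn u (Icc 0 1) := by
  rw [h.eq]
  exact strictAntiOn_radSol h.cont (h.source_nonneg hμ) (h.source_zero_pos hμ)

lemma radAvg_one_pos (h : RadialProfile k s μ q α u F) (hμ : 0 < μ) : 0 < radAvg F 1 :=
  radAvg_pos h.cont zero_le_one (h.source_nonneg hμ) (h.source_zero_pos hμ)

lemma continuous (h : RadialProfile k s μ q α u F) : Continuous u := by
  rw [h.eq]; exact continuous_radSol h.cont α

lemma hasDerivAt (h : RadialProfile k s μ q α u F) (r : ℝ) :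
    HasDerivAt u (-(r * radAvg F r)) r := by
  rw [h.eq]; exact hasDerivAt_radSol h.cont α r

lemma eqOn_of_height_eq {v G : ℝ → ℝ} (h : RadialProfile k s μ q α u F)
    (h' : RadialProfile k s μ q α v G) (hs : 0 ≤ s) (hk : 0 ≤ k) (hμ : 0 < μ) (hq : 1 ≤ q) :
    EqOn u v (Icc 0 1) := by
  obtain ⟨U, -, -, -, hU⟩ := exists_shots hs hk hμ hq h.height_pos.le
  have key : ∀ {w W : ℝ → ℝ}, RadialProfile k s μ q α w W →
      ∀ r ∈ Icc (0:ℝ) 1, w r = radSol (U α) α r := by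
    intro w W hw
    refine hU α w hw.continuous.continuousOn fun r hr => ?_
    refine (congrFun hw.eq r).trans (radSol_congr (fun σ hσ => ?_) hr.1)
    have hσ1 : σ ∈ Icc (0:ℝ) 1 := ⟨hσ.1, hσ.2.trans hr.2⟩
    have hle : w σ ≤ α := by
      have := (hw.strictAntiOn hμ).antitoneOn ⟨le_rfl, zero_le_one⟩ hσ1 hσ.1
      rwa [show w 0 = α by rw [hw.eq, radSol_zero]] at this
    rw [hw.source σ hσ1, clip_eq (hw.nonneg hσ1) hle]
  exact fun r hr => (key h r hr).trans (key h' r hr).symm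

end RadialProfile

/-! ### The Pohozaev-type energy -/

section

variable (k s q : ℝ)

/-- The logarithmic derivative of `1 + |r|^k`, divided by `k`. -/
def logSlope (r : ℝ) : ℝ := |r| ^ k / (1 + |r| ^ k)

/-- The multiplier in the Pohozaev-type identity. -/
def multiplier (r : ℝ) : ℝ := (2 - k * s * logSlope k r) / (q + 3)

/-- The weight `r² (1 + |r|^k)^(-s)`. -/
def sqWt (r : ℝ) : ℝ := r ^ 2 * wt k s r

/-- The integrating factor in the Pohozaev-type identity. -/
def factor (r : ℝ) : ℝ := sqWt k s r ^ (-2 / (q + 3))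

/-- The derivative `r ∂ᵣ` of the multiplier. -/
def multiplierSlope (r : ℝ) : ℝ := -(k * s * (k * logSlope k r * (1 - logSlope k r))) / (q + 3)

variable {k s q}

lemma hasDerivAt_abs_rpow_pos (k : ℝ) {r : ℝ} (hr : 0 < r) :
    HasDerivAt (fun r => |r| ^ k) (k * |r| ^ k / r) r := by
  have h1 : (fun r : ℝ => |r| ^ k) =ᶠ[𝓝 r] fun r => r ^ k := by
    filter_upwards [lt_mem_nhds hr] with x hx
    rw [abs_of_pos hx]
  refine ((Real.hasDerivAt_rpow_const (Or.inl hr.ne')).congr_of_eventuallyEq h1).congr_deriv ?_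
  rw [abs_of_pos hr, Real.rpow_sub_one hr.ne']
  ring

lemma hasDerivAt_logSlope (k : ℝ) {r : ℝ} (hr : 0 < r) :
    HasDerivAt (logSlope k) (k * logSlope k r * (1 - logSlope k r) / r) r := by
  have h1 := hasDerivAt_abs_rpow_pos k hr
  have h2 : 1 + |r| ^ k ≠ 0 := by have := one_le_one_add_abs_rpow k r; linarith
  refine (h1.div (h1.const_add 1) h2).congr_deriv ?_
  unfold logSlope
  field_simp

lemma continuous_logSlope (hk : 0 ≤ k) : Continuous (logSlope k) := by
  have h1 : Continuous fun r : ℝ => |r| ^ k := continuous_abs.rpow_const fun _ => Or.inr hk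
  refine h1.div (continuous_const.add h1) fun r => ?_
  have := one_le_one_add_abs_rpow k r; linarith

lemma continuous_multiplier (hk : 0 ≤ k) (s q : ℝ) : Continuous (multiplier k s q) :=
  (continuous_const.sub (continuous_const.mul (continuous_logSlope hk))).div_const _

lemma logSlope_mem (k r : ℝ) : logSlope k r ∈ Icc (0:ℝ) 1 := by
  have h1 := Real.rpow_nonneg (abs_nonneg r) k
  refine ⟨by unfold logSlope; positivity, ?_⟩
  unfold logSlope
  rw [div_le_one (by positivity)]
  linarith

lemma hasDerivAt_wt (k s : ℝ) {r : ℝ} (hr : 0 < r) :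
    HasDerivAt (wt k s) (-(k * s * logSlope k r) * wt k s r / r) r := by
  have h2 : 1 + |r| ^ k ≠ 0 := by have := one_le_one_add_abs_rpow k r; linarith
  refine (((hasDerivAt_abs_rpow_pos k hr).const_add 1).rpow_const (p := -s) (Or.inl h2)).congr_deriv ?_
  rw [Real.rpow_sub_one h2]
  unfold logSlope wt
  ring

lemma hasDerivAt_multiplier (k s q : ℝ) {r : ℝ} (hr : 0 < r) :
    HasDerivAt (multiplier k s q) (multiplierSlope k s q r / r) r := by
  refine ((((hasDerivAt_logSlope k hr).const_mul (k * s)).const_sub 2).div_const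
    (q + 3)).congr_deriv ?_
  unfold multiplierSlope
  ring

lemma multiplierSlope_nonpos (k : ℝ) (hs : 0 ≤ s) (hq : 0 < q) (r : ℝ) :
    multiplierSlope k s q r ≤ 0 := by
  have h1 := (logSlope_mem k r).1
  have h2 := sub_nonneg.2 (logSlope_mem k r).2
  have h3 : multiplierSlope k s q r
      = -(k ^ 2 * (s * (logSlope k r * (1 - logSlope k r))) / (q + 3)) := by
    unfold multiplierSlope; ring
  rw [h3, neg_nonpos]
  positivity

lemma sqWt_pos (k s : ℝ) {r : ℝ} (hr : 0 < r) : 0 < sqWt k s r :=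
  mul_pos (pow_pos hr 2) (wt_pos k s r)

lemma hasDerivAt_sqWt (k s : ℝ) (hq : q + 3 ≠ 0) {r : ℝ} (hr : 0 < r) :
    HasDerivAt (sqWt k s) ((q + 3) * multiplier k s q r * sqWt k s r / r) r := by
  refine ((hasDerivAt_pow 2 r).mul (hasDerivAt_wt k s hr)).congr_deriv ?_
  unfold multiplier sqWt
  field_simp
  ring

lemma factor_pos (k s q : ℝ) {r : ℝ} (hr : 0 < r) : 0 < factor k s q r :=
  Real.rpow_pos_of_pos (sqWt_pos k s hr) _

lemma hasDerivAt_factor (k s : ℝ) (hq : q + 3 ≠ 0) {r : ℝ} (hr : 0 < r) :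
    HasDerivAt (factor k s q) (-2 * multiplier k s q r * factor k s q r / r) r := by
  have h0 := (sqWt_pos k s hr).ne'
  refine ((hasDerivAt_sqWt k s hq hr).rpow_const (p := -2 / (q + 3)) (Or.inl h0)).congr_deriv ?_
  rw [Real.rpow_sub_one h0]
  unfold factor
  field_simp

/-- The regularised factor `r² H^(-2/(q+3))`, continuous up to the origin. -/
def regFactor (k s q r : ℝ) : ℝ := sqWt k s r ^ (1 - 2 / (q + 3)) / wt k s r

lemma continuous_regFactor (hk : 0 ≤ k) (s : ℝ) (hq : 0 < q) : Continuous (regFactor k s q) := by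
  have h1 := continuous_wt hk s
  have h2 : Continuous (sqWt k s) := (continuous_pow 2).mul h1
  refine (h2.rpow_const fun _ => Or.inr ?_).div h1 fun r => (wt_pos k s r).ne'
  rw [sub_nonneg, div_le_one (by linarith)]
  linarith

lemma regFactor_zero (k s : ℝ) (hq : 0 < q) : regFactor k s q 0 = 0 := by
  have : 1 - 2 / (q + 3) ≠ 0 := by
    have : 2 / (q + 3) < 1 := by rw [div_lt_one (by linarith)]; linarith
    linarith
  simp [regFactor, sqWt, Real.zero_rpow this]

lemma regFactor_eq (k s q : ℝ) {r : ℝ} (hr : 0 < r) :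
    regFactor k s q r = factor k s q r * r ^ 2 := by
  have h0 := sqWt_pos k s hr
  have h1 := (wt_pos k s r).ne'
  rw [regFactor, show 1 - 2 / (q + 3) = -2 / (q + 3) + 1 by ring, Real.rpow_add_one h0.ne', factor,
    sqWt]
  field_simp

/-- The Pohozaev-type energy of `u = radSol F α`. -/
def energy (k s q : ℝ) (u F : ℝ → ℝ) (r : ℝ) : ℝ :=
  (r ^ 2 * radAvg F r) ^ 2 / 2 - multiplier k s q r * u r * (r ^ 2 * radAvg F r)
    + sqWt k s r * u r ^ (q + 1) / (q + 1)

lemma RadialProfile.hasDerivAt_factor_mul_energy {μ α : ℝ} {u F : ℝ → ℝ}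
    (h : RadialProfile k s μ q α u F) (hq : 0 < q) {r : ℝ} (hr : r ∈ Ioo (0:ℝ) 1) :
    HasDerivAt (fun r => factor k s q r * energy k s q u F r)
      (factor k s q r * (-(u r * (r ^ 2 * radAvg F r)) *
        (multiplierSlope k s q r - 2 * multiplier k s q r ^ 2 - μ * r ^ 2)
        - multiplier k s q r * μ * r ^ 2 * u r ^ 2) / r) r := by
  have hu := h.pos r ⟨hr.1.le, hr.2⟩
  have hr0 := hr.1.ne'
  have hq3 : q + 3 ≠ 0 := by linarith
  have hq1 : q + 1 ≠ 0 := by linarith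
  have dP := hasDerivAt_sq_mul_radAvg h.cont r
  have du := h.hasDerivAt r
  have dpow := (du.rpow_const (p := q + 1) (Or.inl hu.ne'))
  have dE := ((dP.pow 2).div_const 2).sub (((hasDerivAt_multiplier k s q hr.1).mul du).mul dP)
    |>.add (((hasDerivAt_sqWt k s hq3 hr.1).mul dpow).div_const (q + 1))
  refine ((hasDerivAt_factor k s hq3 hr.1).mul dE).congr_deriv ?_
  have e1 : u r ^ (q + 1) = u r ^ q * u r := Real.rpow_add_one hu.ne' q
  have e2 : F r = μ * u r + wt k s r * u r ^ q := h.source r ⟨hr.1.le, hr.2.le⟩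
  simp only [add_sub_cancel_right, e1, Pi.mul_apply, Pi.sub_apply, Pi.add_apply,
    Pi.pow_apply, Nat.cast_ofNat, Nat.add_one_sub_one, pow_one]
  rw [e2]
  unfold sqWt
  field_simp
  ring

end

section

variable {k s μ q α β : ℝ} {u F v G : ℝ → ℝ}

/-- The Wronskian-type quantity `r (v' u - v u')` of two radial profiles. -/
def wronsk (u F v G : ℝ → ℝ) (r : ℝ) : ℝ :=
  v r * (r ^ 2 * radAvg F r) - r ^ 2 * radAvg G r * u r

/-- The reduced form of `(v/u)² K(u) - K(v)`, where `K` is the energy. -/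
def gap (k s q : ℝ) (u F v G : ℝ → ℝ) (r : ℝ) : ℝ :=
  -((v r / u r * radAvg F r - radAvg G r) *
      (multiplier k s q r * v r - r ^ 2 * (v r / u r * radAvg F r + radAvg G r) / 2))
    + wt k s r / (q + 1) * v r ^ 2 * (u r ^ (q - 1) - v r ^ (q - 1))

namespace RadialProfile

lemma hasDerivAt_wronsk (h : RadialProfile k s μ q α u F) (h' : RadialProfile k s μ q β v G)
    {r : ℝ} (hr : r ∈ Ioo (0:ℝ) 1) :
    HasDerivAt (wronsk u F v G) (-(r * wt k s r * (u r * v r) *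
      (v r ^ (q - 1) - u r ^ (q - 1)))) r := by
  have hr1 := Ioo_subset_Icc_self hr
  have hu := h.pos r ⟨hr.1.le, hr.2⟩
  have hv := h'.pos r ⟨hr.1.le, hr.2⟩
  refine (((h'.hasDerivAt r).mul (hasDerivAt_sq_mul_radAvg h.cont r)).sub
    ((hasDerivAt_sq_mul_radAvg h'.cont r).mul (h.hasDerivAt r))).congr_deriv ?_
  rw [h.source r hr1, h'.source r hr1]
  have e1 : u r ^ q = u r ^ (q - 1) * u r := by rw [← Real.rpow_add_one hu.ne', sub_add_cancel]
  have e2 : v r ^ q = v r ^ (q - 1) * v r := by rw [← Real.rpow_add_one hv.ne', sub_add_cancel]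
  unfold src
  rw [e1, e2]
  ring

lemma continuous_wronsk (h : RadialProfile k s μ q α u F) (h' : RadialProfile k s μ q β v G) :
    Continuous (wronsk u F v G) := by
  have := continuous_radAvg h.cont
  have := continuous_radAvg h'.cont
  have := h.continuous
  have := h'.continuous
  unfold wronsk
  fun_prop

lemma hasDerivAt_ratio (h : RadialProfile k s μ q α u F) (h' : RadialProfile k s μ q β v G)
    {r : ℝ} (hr : r ∈ Ioo (0:ℝ) 1) :
    HasDerivAt (fun r => v r / u r) (wronsk u F v G r / (u r ^ 2 * r)) r := by
  have hu := h.pos r ⟨hr.1.le, hr.2⟩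
  have hr0 := hr.1.ne'
  refine ((h'.hasDerivAt r).div (h.hasDerivAt r) hu.ne').congr_deriv ?_
  unfold wronsk
  field_simp
  ring

lemma factor_mul_gap (h : RadialProfile k s μ q α u F) (h' : RadialProfile k s μ q β v G)
    {r : ℝ} (hr : r ∈ Ioo (0:ℝ) 1) :
    regFactor k s q r * gap k s q u F v G r
      = (v r / u r) ^ 2 * (factor k s q r * energy k s q u F r)
        - factor k s q r * energy k s q v G r := by
  have hu := h.pos r ⟨hr.1.le, hr.2⟩
  have hv := h'.pos r ⟨hr.1.le, hr.2⟩
  have e1 : u r ^ (q + 1) = u r ^ (q - 1) * u r ^ 2 := by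
    rw [show q + 1 = q - 1 + (2:ℕ) by push_cast; ring, Real.rpow_add_natCast hu.ne']
  have e2 : v r ^ (q + 1) = v r ^ (q - 1) * v r ^ 2 := by
    rw [show q + 1 = q - 1 + (2:ℕ) by push_cast; ring, Real.rpow_add_natCast hv.ne']
  rw [regFactor_eq k s q hr.1]
  unfold gap energy sqWt
  rw [e1, e2]
  generalize q + 1 = c
  field_simp
  ring

lemma hasDerivAt_gap (h : RadialProfile k s μ q α u F) (h' : RadialProfile k s μ q β v G)
    (hq : 0 < q) {r : ℝ} (hr : r ∈ Ioo (0:ℝ) 1) :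
    HasDerivAt (fun r => regFactor k s q r * gap k s q u F v G r)
      (2 * (v r / u r) * (wronsk u F v G r / (u r ^ 2 * r)) * (factor k s q r *
        ((multiplier k s q r * u r - r ^ 2 * radAvg F r) ^ 2 / 2
          + (multiplier k s q r ^ 2 / 2 - multiplierSlope k s q r / 2) * u r ^ 2
          + μ * r ^ 2 * u r ^ 2 / 2 + sqWt k s r * u r ^ (q + 1) / (q + 1)))) r := by
  have hev : (fun r => regFactor k s q r * gap k s q u F v G r) =ᶠ[𝓝 r]
      fun r => (v r / u r) ^ 2 * (factor k s q r * energy k s q u F r)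
        - factor k s q r * energy k s q v G r := by
    filter_upwards [isOpen_Ioo.mem_nhds hr] with x hx using h.factor_mul_gap h' hx
  refine (((((h.hasDerivAt_ratio h' hr).pow 2).mul (h.hasDerivAt_factor_mul_energy hq hr)).sub
    (h'.hasDerivAt_factor_mul_energy hq hr)).congr_of_eventuallyEq hev).congr_deriv ?_
  have hu := h.pos r ⟨hr.1.le, hr.2⟩
  have hr0 := hr.1.ne'
  simp only [Pi.pow_apply, Nat.cast_ofNat, Nat.add_one_sub_one, pow_one]
  unfold energy wronsk
  generalize sqWt k s r * u r ^ (q + 1) / (q + 1) = z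
  field_simp
  ring

lemma gap_deriv_neg (h : RadialProfile k s μ q α u F) (h' : RadialProfile k s μ q β v G)
    (hs : 0 ≤ s) (hμ : 0 < μ) (hq : 0 < q) {r : ℝ} (hr : r ∈ Ioo (0:ℝ) 1)
    (hD : wronsk u F v G r < 0) :
    deriv (fun r => regFactor k s q r * gap k s q u F v G r) r < 0 := by
  rw [(h.hasDerivAt_gap h' hq hr).deriv]
  have hu := h.pos r ⟨hr.1.le, hr.2⟩
  have hv := h'.pos r ⟨hr.1.le, hr.2⟩
  have hr0 := hr.1
  have h1 := factor_pos k s q hr0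
  have h2 := sqWt_pos k s hr0
  have h3 := multiplierSlope_nonpos k hs hq r
  have h4 := Real.rpow_pos_of_pos hu (q + 1)
  have h5 : 0 ≤ multiplier k s q r ^ 2 / 2 - multiplierSlope k s q r / 2 := by
    have := sq_nonneg (multiplier k s q r); linarith
  refine mul_neg_of_neg_of_pos ?_ (by positivity)
  refine mul_neg_of_pos_of_neg (by positivity) (div_neg_of_neg_of_pos hD (by positivity))

lemma continuousAt_gap (h : RadialProfile k s μ q α u F) (h' : RadialProfile k s μ q β v G)
    (hk : 0 ≤ k) (hq : 1 < q) {r : ℝ} (hr : r ∈ Ico (0:ℝ) 1) :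
    ContinuousAt (fun r => regFactor k s q r * gap k s q u F v G r) r := by
  have hu := (h.pos r hr).ne'
  have c1 := (continuous_radAvg h.cont).continuousAt (x := r)
  have c2 := (continuous_radAvg h'.cont).continuousAt (x := r)
  have c3 := h.continuous.continuousAt (x := r)
  have c4 := h'.continuous.continuousAt (x := r)
  have c5 := (continuous_multiplier hk s q).continuousAt (x := r)
  have c6 := (continuous_wt hk s).continuousAt (x := r)
  have c7 := (continuous_regFactor hk s (by linarith : 0 < q)).continuousAt (x := r)
  have c8 : ContinuousAt (fun r => u r ^ (q - 1)) r := c3.rpow_const (Or.inr (by linarith))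
  have c9 : ContinuousAt (fun r => v r ^ (q - 1)) r := c4.rpow_const (Or.inr (by linarith))
  have c10 : ContinuousAt (fun r => v r / u r) r := c4.div c3 hu
  unfold gap
  exact c7.mul ((((c10.mul c1).sub c2).mul ((c5.mul c4).sub
    (((continuousAt_id.pow 2).mul ((c10.mul c1).add c2)).div_const 2))).neg.add
    (((c6.div_const _).mul (c4.pow 2)).mul (c8.sub c9)))

lemma tendsto_gap_one (h : RadialProfile k s μ q α u F) (h' : RadialProfile k s μ q β v G)
    (hk : 0 ≤ k) (hμ : 0 < μ) (hq : 1 < q) :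
    Tendsto (fun r => regFactor k s q r * gap k s q u F v G r) (𝓝[<] 1) (𝓝 0) := by
  have hg := (h.radAvg_one_pos hμ).ne'
  have hsub : 𝓝[<] (1:ℝ) ≤ 𝓝 1 := nhdsWithin_le_nhds
  have slope_lim : ∀ {w W : ℝ → ℝ} {γ : ℝ}, RadialProfile k s μ q γ w W →
      Tendsto (fun r => (r - 1)⁻¹ * w r) (𝓝[<] 1) (𝓝 (-radAvg W 1)) := by
    intro w W γ hw
    have h1 := (hasDerivAt_iff_tendsto_slope.1 (hw.hasDerivAt 1)).mono_left
      (nhdsWithin_mono (1:ℝ) (fun x hx => (ne_of_lt hx : x ≠ 1)) : 𝓝[<] (1:ℝ) ≤ 𝓝[≠] 1)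
    rw [one_mul] at h1
    refine h1.congr fun r => ?_
    simp [slope, hw.zero]
  have hw : Tendsto (fun r => v r / u r) (𝓝[<] 1) (𝓝 (radAvg G 1 / radAvg F 1)) := by
    have h1 := (slope_lim h').div (slope_lim h) (neg_ne_zero.2 hg)
    rw [neg_div_neg_eq] at h1
    refine h1.congr' ?_
    filter_upwards [self_mem_nhdsWithin] with r hr
    have : r - 1 ≠ 0 := by have : r < 1 := hr; linarith
    exact mul_div_mul_left _ _ (inv_ne_zero this)
  have c1 := ((continuous_radAvg h.cont).tendsto 1).mono_left hsub
  have c2 := ((continuous_radAvg h'.cont).tendsto 1).mono_left hsub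
  have c4 := (h'.continuous.tendsto 1).mono_left hsub
  have c5 := ((continuous_multiplier hk s q).tendsto 1).mono_left hsub
  have c6 := ((continuous_wt hk s).tendsto 1).mono_left hsub
  have c7 := ((continuous_regFactor hk s (by linarith : 0 < q)).tendsto 1).mono_left hsub
  have c8 := ((h.continuous.rpow_const (p := q - 1) fun _ => Or.inr (by linarith)).tendsto
    1).mono_left hsub
  have c9 := ((h'.continuous.rpow_const (p := q - 1) fun _ => Or.inr (by linarith)).tendsto
    1).mono_left hsub
  have c0 : Tendsto (fun r : ℝ => r) (𝓝[<] 1) (𝓝 1) := hsub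
  have key := c7.mul ((((hw.mul c1).sub c2).mul ((c5.mul c4).sub
    (((c0.pow 2).mul ((hw.mul c1).add c2)).div_const 2))).neg.add
    (((c6.div_const (q + 1)).mul (c4.pow 2)).mul (c8.sub c9)))
  rw [h'.zero, div_mul_cancel₀ _ hg, sub_self] at key
  unfold gap
  simpa only [zero_mul, neg_zero, zero_add, ne_eq, OfNat.ofNat_ne_zero, not_false_eq_true,
    zero_pow, mul_zero] using key

lemma not_height_lt (h : RadialProfile k s μ q α u F) (h' : RadialProfile k s μ q β v G)
    (hs : 0 ≤ s) (hk : 0 ≤ k) (hμ : 0 < μ) (hq : 1 < q) : ¬ α < β := by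
  intro hαβ
  have hq0 : 0 < q := by linarith
  have hDc := h.continuous_wronsk h'
  have hD0 : wronsk u F v G 0 = 0 := by simp [wronsk]
  have hD1 : wronsk u F v G 1 = 0 := by simp [wronsk, h.zero, h'.zero]
  obtain ⟨a, ha, ha0, hapos⟩ := exists_first_zero (f := fun r => v r - u r)
    (h'.continuous.sub h.continuous) (a := 1)
    (by rw [h.eq, h'.eq, radSol_zero, radSol_zero]; linarith) zero_le_one
    (by rw [h.zero, h'.zero, sub_self])
  have hanti : StrictAntiOn (wronsk u F v G) (Icc 0 a) := by
    refine strictAntiOn_of_deriv_neg (convex_Icc 0 a) hDc.continuousOn fun r hr => ?_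
    rw [interior_Icc] at hr
    have hr1 : r ∈ Ioo (0:ℝ) 1 := ⟨hr.1, hr.2.trans_le ha.2⟩
    rw [(h.hasDerivAt_wronsk h' hr1).deriv, neg_neg_iff_pos]
    have hu := h.pos r ⟨hr1.1.le, hr1.2⟩
    have hv := h'.pos r ⟨hr1.1.le, hr1.2⟩
    have h1 := Real.rpow_lt_rpow hu.le (sub_pos.1 (hapos r ⟨hr.1.le, hr.2⟩))
      (by linarith : 0 < q - 1)
    have := wt_pos k s r
    have := hr.1
    have := sub_pos.2 h1
    positivity
  have hneg : ∀ r ∈ Ioc 0 a, wronsk u F v G r < 0 := fun r hr => by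
    have := hanti ⟨le_rfl, ha.1.le⟩ ⟨hr.1.le, hr.2⟩ hr.1
    rwa [hD0] at this
  have ha1 : a < 1 := ha.2.lt_of_ne fun h => (hneg 1 (by rw [h]; exact ⟨one_pos, le_rfl⟩)).ne hD1
  obtain ⟨b, hb, hb0, hbpos⟩ := exists_first_zero (f := fun t => -wronsk u F v G (a + t))
    (by fun_prop) (a := 1 - a) (by simpa using hneg a ⟨ha.1, le_rfl⟩) (by linarith)
    (by simp [hD1])
  set c := a + b with hc
  have hac : a < c := by linarith [hb.1]
  have hc0 : 0 < c := ha.1.trans hac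
  have hc1 : c ≤ 1 := by linarith [hb.2]
  have hDc0 : wronsk u F v G c = 0 := neg_eq_zero.1 hb0
  have hnegc : ∀ r ∈ Ioo 0 c, wronsk u F v G r < 0 := fun r hr => by
    rcases le_total r a with hra | hra
    · exact hneg r ⟨hr.1, hra⟩
    · have := hbpos (r - a) ⟨by linarith, by linarith [hr.2]⟩
      rw [add_sub_cancel] at this
      linarith
  set X := fun r => regFactor k s q r * gap k s q u F v G r with hX
  have hX0 : X 0 = 0 := by simp [hX, regFactor_zero k s hq0]
  have hXanti : ∀ d, d < 1 → d ≤ c → StrictAntiOn X (Icc 0 d) := by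
    intro d hd hdc
    refine strictAntiOn_of_deriv_neg (convex_Icc 0 d) (fun r hr =>
      (h.continuousAt_gap h' hk hq ⟨hr.1, hr.2.trans_lt hd⟩).continuousWithinAt) fun r hr => ?_
    rw [interior_Icc] at hr
    exact h.gap_deriv_neg h' hs hμ hq0 ⟨hr.1, hr.2.trans hd⟩ (hnegc r ⟨hr.1, hr.2.trans_le hdc⟩)
  rcases hc1.lt_or_eq with hc1 | hc1
  · have h1 : X c < 0 := by
      have := hXanti c hc1 le_rfl ⟨le_rfl, hc0.le⟩ ⟨hc0.le, le_rfl⟩ hc0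
      rwa [hX0] at this
    have hw : StrictAntiOn (fun r => v r / u r) (Icc a c) := by
      refine strictAntiOn_of_deriv_neg (convex_Icc a c) (fun r hr => ?_) fun r hr => ?_
      · exact (h.hasDerivAt_ratio h' ⟨ha.1.trans_le hr.1,
          hr.2.trans_lt hc1⟩).continuousAt.continuousWithinAt
      · rw [interior_Icc] at hr
        have hr0 : 0 < r := ha.1.trans hr.1
        have hr1 : r < 1 := hr.2.trans hc1
        rw [(h.hasDerivAt_ratio h' ⟨hr0, hr1⟩).deriv]
        have := h.pos r ⟨hr0.le, hr1⟩
        exact div_neg_of_neg_of_pos (hnegc r ⟨hr0, hr.2⟩) (by positivity)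
    have hwc := hw ⟨le_rfl, hac.le⟩ ⟨hac.le, le_rfl⟩ hac
    have hua := h.pos a ⟨ha.1.le, ha1⟩
    have huc := h.pos c ⟨hc0.le, hc1⟩
    have hvc := h'.pos c ⟨hc0.le, hc1⟩
    simp only [sub_eq_zero.1 ha0, div_self hua.ne', div_lt_one huc] at hwc
    have hz : v c / u c * radAvg F c - radAvg G c = 0 := by
      unfold wronsk at hDc0
      have : c ^ 2 * (v c * radAvg F c - radAvg G c * u c) = 0 := by linarith
      have := (mul_eq_zero.1 this).resolve_left (by positivity)
      field_simp
      linarith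
    have hp := Real.rpow_lt_rpow hvc.le hwc (by linarith : 0 < q - 1)
    have : 0 < X c := by
      simp only [hX, gap, hz, zero_mul, neg_zero, zero_add, regFactor_eq k s q hc0]
      have := factor_pos k s q hc0
      have := wt_pos k s c
      have := sub_pos.2 hp
      positivity
    linarith
  · have h1 : X (1 / 2) < 0 := by
      have := hXanti (1 / 2) (by norm_num) (by rw [hc1]; norm_num) ⟨le_rfl, by norm_num⟩
        ⟨by norm_num, le_rfl⟩ (by norm_num)
      rwa [hX0] at this
    have h2 : (0:ℝ) ≤ X (1 / 2) := by
      refine le_of_tendsto (h.tendsto_gap_one h' hk hμ hq) ?_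
      filter_upwards [Ioo_mem_nhdsLT (by norm_num : (1 / 2 : ℝ) < 1)] with r hr
      have hr0 : (0:ℝ) ≤ r := by linarith [hr.1]
      exact (hXanti r hr.2 (hr.2.le.trans_eq hc1.symm)).antitoneOn ⟨by norm_num, hr.1.le⟩
        ⟨hr0, le_rfl⟩ hr.1.le
    linarith

theorem eqOn (h : RadialProfile k s μ q α u F) (h' : RadialProfile k s μ q β v G)
    (hs : 0 ≤ s) (hk : 0 ≤ k) (hμ : 0 < μ) (hq : 1 < q) : EqOn u v (Icc 0 1) := by
  obtain rfl : α = β := le_antisymm (not_lt.1 (h'.not_height_lt h hs hk hμ hq))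
    (not_lt.1 (h.not_height_lt h' hs hk hμ hq))
  exact h.eqOn_of_height_eq h' hs hk hμ hq.le

end RadialProfile

end

/-- for `-Δu + λu = (1+|x|^k)^{-s} u^{p-1}` on the unit ball, with `N = 2`,
`-λ₁(B) < λ < 0`, `2 < p ≤ 6` and `2ks ≤ 6 - p`, there is exactly one positive solution,
and it is radially symmetric and decreasing in `r = |x|`. -/
theorem statement13 {N : ℕ} (hN2 : N = 2) {s k p lam : ℝ} (hs : 1 < s) (hk : 0 ≤ k)
    (hp2 : 2 < p) (hpcrit : 3 ≤ N → p < 2 * N / ((N : ℝ) - 2))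
    (hlam1 : - firstEig (Metric.ball (0 : Euc N) 1) < lam) (hlam0 : lam < 0)
    (hp6 : p ≤ 6) (hks : 2 * k * s ≤ 6 - p) :
    ∃ u : Euc N → ℝ,
      IsPosSolution (Metric.ball (0 : Euc N) 1) (fker N k s p) lam u ∧
      (∀ v : Euc N → ℝ, IsPosSolution (Metric.ball (0 : Euc N) 1) (fker N k s p) lam v →
        EqOn v u (closure (Metric.ball (0 : Euc N) 1))) ∧
      ∃ ρ : ℝ → ℝ, (∀ x ∈ closure (Metric.ball (0 : Euc N) 1), u x = ρ ‖x‖) ∧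
        StrictAntiOn ρ (Icc (0 : ℝ) 1) := by
  subst hN2
  have hs0 : 0 ≤ s := by linarith
  have hμ : 0 < -lam := by linarith
  have hq : 1 < p - 1 := by linarith
  obtain ⟨α, u, F, h⟩ := exists_radialProfile (q := p - 1) hs0 hk hμ hq (by linarith)
  refine ⟨fun x => u ‖x‖, h.isPosSolution, ?_, u, fun x _ => rfl, h.strictAntiOn hμ⟩
  intro v hv x hx
  rw [closure_unitBall, mem_closedBall_zero_iff] at hx
  obtain ⟨β, w, G, h', hvw⟩ := exists_profile_of_isPosSolution hs0 hk hp2 hlam0 hv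
  rw [hvw x hx]
  exact h'.eqOn h hs0 hk hμ hq ⟨norm_nonneg x, hx⟩
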